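/- arXiv:1906.03513 — 7 statements merged into one kernel-verified Lean document; each statement's English description precedes it below -/
import Mathlib

section
/- Let w_1,…,w_N and W be nonnegative integers, and consider the feasibility system on the complete binary scenario tree with 3 stages and nodes {1,…,7} (node 1 the root, nodes 2,3 its children, nodes 4,5 children of 2, nodes 6,7 children of 3), with real variables α_{in}, β_{in} for i = 1,…,N and n = 1,…,7, revision variables t_i* ∈ {1,2,3}, and constraints: α_{i2} − β_{i2} = α_{i1}; α_{i3} − β_{i3} = −α_{i1}; α_{i4} − β_{i4} = α_{i1}; α_{i5} − β_{i5} = 2 − α_{i1}; α_{i6} − β_{i6} = α_{i1}; α_{i7} − β_{i7} = 2 − α_{i1}; Σ_{i=1}^N w_i α_{i1} = W; together with the adaptive two-stage nonanticipativity constraints α_{im} = α_{in} and β_{im} = β_{in} for all m, n in the same stage t with t < t_i*, and α_{im} = α_{in}, β_{im} = β_{in} for all m, n in the same stage t lying in the same subtree rooted at a stage-t_i* node, for t ≥ t_i*. Then this system is feasible if and only if there exists a subset S ⊆ {1,…,N} with Σ_{i∈S} w_i = W. -/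
open scoped Classical

noncomputable section

/-- Stage of each node of the complete binary scenario tree with 3 stages.  The nodes
`0, 1, …, 6 : Fin 7` stand for the paper's nodes `1, 2, …, 7`: node `0` is the root
(stage 1), nodes `1, 2` form stage 2, and nodes `3, 4, 5, 6` form stage 3. -/
def stage7 (n : Fin 7) : ℕ :=
  if n.val = 0 then 1 else if n.val ≤ 2 then 2 else 3

/-- Ancestor map of the complete binary scenario tree with 3 stages: node `0` is the
root, nodes `1, 2` are children of `0`, nodes `3, 4` are children of `1`, and nodes
`5, 6` are children of `2`. -/
def parent7 (n : Fin 7) : Fin 7 :=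
  if n.val = 0 then 0 else if n.val ≤ 2 then 0 else if n.val ≤ 4 then 1 else 2

/-- `m` lies on the path from the root to `n`; equivalently `n` belongs to the subtree
rooted at `m`. -/
def onPath7 (m n : Fin 7) : Prop := ∃ k : ℕ, parent7^[k] n = m

/-- Adaptive two-stage nonanticipativity constraints with revision time `t*`:
equality across all nodes of each stage strictly before `t*`, and equality across
nodes of each stage at or after `t*` that belong to the same subtree rooted at a
stage-`t*` node. -/
def nonanticip7 (tstar : ℕ) (v : Fin 7 → ℝ) : Prop :=
  (∀ m n, stage7 m = stage7 n → stage7 m < tstar → v m = v n) ∧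
  (∀ j, stage7 j = tstar → ∀ m n, onPath7 j m → onPath7 j n →
    stage7 m = stage7 n → v m = v n)

/-- The linear constraints of one coordinate `i` of the subset-sum reduction:
`α_{i2} − β_{i2} = α_{i1}`, `α_{i3} − β_{i3} = −α_{i1}`, `α_{i4} − β_{i4} = α_{i1}`,
`α_{i5} − β_{i5} = 2 − α_{i1}`, `α_{i6} − β_{i6} = α_{i1}`, `α_{i7} − β_{i7} = 2 − α_{i1}`
(here node `j+1` of the paper is index `j : Fin 7`). -/
def coordConstraints7 (α β : Fin 7 → ℝ) : Prop :=
  α 1 - β 1 = α 0 ∧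
  α 2 - β 2 = -α 0 ∧
  α 3 - β 3 = α 0 ∧
  α 4 - β 4 = 2 - α 0 ∧
  α 5 - β 5 = α 0 ∧
  α 6 - β 6 = 2 - α 0

theorem onPath7_cases {j m : Fin 7} (h : onPath7 j m) : j = m ∨ j = parent7 m ∨ j = 0 := by
  obtain ⟨k, hk⟩ := h
  match k, hk with
  | 0, hk => left; exact hk.symm
  | 1, hk => right; left; exact hk.symm
  | k + 2, hk =>
    right; right
    rw [← hk, Function.iterate_add_apply]
    have h2 : ∀ m : Fin 7, parent7^[2] m = 0 := by decide
    rw [h2]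
    exact Function.iterate_fixed (by decide) k

/-- Feasibility of one coordinate forces a binary value at the root. -/
theorem root_binary {α β : Fin 7 → ℝ} {t : ℕ} (ht : t ∈ ({1, 2, 3} : Set ℕ))
    (hc : coordConstraints7 α β) (ha : nonanticip7 t α) (hb : nonanticip7 t β) :
    α 0 = 0 ∨ α 0 = 1 := by
  obtain ⟨h1, h2, h3, h4, h5, h6⟩ := hc
  have key12 : ∀ v : Fin 7 → ℝ, nonanticip7 3 v → v 1 = v 2 := fun v hv =>
    hv.1 1 2 (by decide) (by decide)
  have key34 : ∀ v : Fin 7 → ℝ, nonanticip7 2 v → v 3 = v 4 := fun v hv =>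
    hv.2 1 (by decide) 3 4 ⟨1, by decide⟩ ⟨1, by decide⟩ (by decide)
  have key34' : ∀ v : Fin 7 → ℝ, nonanticip7 1 v → v 3 = v 4 := fun v hv =>
    hv.2 0 (by decide) 3 4 ⟨2, by decide⟩ ⟨2, by decide⟩ (by decide)
  rcases ht with rfl | rfl | rfl
  · right; linarith [key34' α ha, key34' β hb]
  · right; linarith [key34 α ha, key34 β hb]
  · left; linarith [key12 α ha, key12 β hb]

theorem nonanticip7_const (t : ℕ) (c : ℝ) : nonanticip7 t (fun _ => c) :=
  ⟨fun _ _ _ _ => rfl, fun _ _ _ _ _ _ _ => rfl⟩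

theorem nonanticip7_one :
    nonanticip7 2 (fun n => if n = 2 then -1 else 1) := by
  have d1 : ∀ m n : Fin 7, stage7 m = stage7 n → stage7 m < 2 → (m = 2 ↔ n = 2) := by decide
  have d2 : ∀ j : Fin 7, stage7 j = 2 → ∀ m n : Fin 7, (j = m ∨ j = parent7 m ∨ j = 0) →
    (j = n ∨ j = parent7 n ∨ j = 0) → stage7 m = stage7 n → (m = 2 ↔ n = 2) := by decide
  refine ⟨fun m n h h' => ?_, fun j hj m n hm hn h => ?_⟩
  · simp only [d1 m n h h']
  · simp only [d2 j hj m n (onPath7_cases hm) (onPath7_cases hn) h]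

theorem nonanticip7_zero :
    nonanticip7 3 (fun n => if n = 4 ∨ n = 6 then 2 else 0) := by
  have d1 : ∀ m n : Fin 7, stage7 m = stage7 n → stage7 m < 3 →
    ((m = 4 ∨ m = 6) ↔ (n = 4 ∨ n = 6)) := by decide
  have d2 : ∀ j : Fin 7, stage7 j = 3 → ∀ m n : Fin 7, (j = m ∨ j = parent7 m ∨ j = 0) →
    (j = n ∨ j = parent7 n ∨ j = 0) → stage7 m = stage7 n →
    ((m = 4 ∨ m = 6) ↔ (n = 4 ∨ n = 6)) := by decide
  refine ⟨fun m n h h' => ?_, fun j hj m n hm hn h => ?_⟩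
  · simp only [d1 m n h h']
  · simp only [d2 j hj m n (onPath7_cases hm) (onPath7_cases hn) h]

/-- **NP-hardness reduction (Theorem 2)**: the feasibility system of the adaptive
two-stage program built on the complete binary 3-stage scenario tree is feasible if
and only if the subset-sum instance `(w, W)` has a solution. -/
theorem adaptive_feasibility_iff_subset_sum (N : ℕ) (w : Fin N → ℕ) (W : ℕ) :
    (∃ (α β : Fin N → Fin 7 → ℝ) (tstar : Fin N → ℕ),
      (∀ i, tstar i ∈ ({1, 2, 3} : Set ℕ)) ∧
      (∀ i, coordConstraints7 (α i) (β i)) ∧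
      (∑ i, (w i : ℝ) * α i 0) = (W : ℝ) ∧
      (∀ i, nonanticip7 (tstar i) (α i) ∧ nonanticip7 (tstar i) (β i)))
    ↔ ∃ S : Finset (Fin N), ∑ i ∈ S, w i = W := by
  constructor
  · rintro ⟨α, β, t, ht, hc, hs, hn⟩
    refine ⟨Finset.univ.filter (fun i => α i 0 = 1), ?_⟩
    have hR : ((∑ i ∈ Finset.univ.filter (fun i => α i 0 = 1), w i : ℕ) : ℝ) = (W : ℝ) := by
      rw [← hs, Nat.cast_sum, Finset.sum_filter]
      refine Finset.sum_congr rfl fun i _ => ?_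
      rcases root_binary (ht i) (hc i) (hn i).1 (hn i).2 with h | h <;> simp [h]
    exact_mod_cast hR
  · rintro ⟨S, hS⟩
    refine ⟨fun i => if i ∈ S then (fun n => if n = 2 then -1 else 1)
        else (fun n => if n = 4 ∨ n = 6 then 2 else 0),
      fun _ _ => 0, fun i => if i ∈ S then 2 else 3, ?_, ?_, ?_, ?_⟩
    · intro i
      by_cases h : i ∈ S <;> simp [h]
    · intro i
      by_cases h : i ∈ S
      · simp only [h, if_true, coordConstraints7]
        norm_num [Fin.ext_iff]
      · simp only [h, if_false, coordConstraints7]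
        norm_num [Fin.ext_iff]
    · have e : ∀ i ∈ Finset.univ, (w i : ℝ) * (if i ∈ S then (fun n : Fin 7 => if n = 2 then (-1 : ℝ) else 1)
          else (fun n => if n = 4 ∨ n = 6 then 2 else 0)) 0 = if i ∈ S then (w i : ℝ) else 0 := by
        intro i _
        by_cases h : i ∈ S <;> simp [h, Fin.ext_iff]
      rw [← hS, Nat.cast_sum, Finset.sum_congr rfl e]
      simp
    · intro i
      refine ⟨?_, nonanticip7_const _ 0⟩
      by_cases h : i ∈ S
      · simp only [h, if_true]; exact nonanticip7_one
      · simp only [h, if_false]; exact nonanticip7_zero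

end
end

section
/- In the feasibility system of the subset-sum reduction on the complete binary 3-stage scenario tree (constraints: α_{i2} − β_{i2} = α_{i1}; α_{i3} − β_{i3} = −α_{i1}; α_{i4} − β_{i4} = α_{i1}; α_{i5} − β_{i5} = 2 − α_{i1}; α_{i6} − β_{i6} = α_{i1}; α_{i7} − β_{i7} = 2 − α_{i1}; Σ_i w_i α_{i1} = W; plus adaptive two-stage nonanticipativity constraints determined by t_i* ∈ {1,2,3}), the following hold for each i: (1) if t_i* = 1 then the system restricted to coordinate i is infeasible; (2) if t_i* = 2 then every feasible solution has α_{i1} = 1; (3) if t_i* = 3 then every feasible solution has α_{i1} = 0. -/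
open scoped Classical

noncomputable section

/-- **Lemma 2**: in the subset-sum reduction on the complete binary 3-stage scenario
tree, for each coordinate: (1) revision time `t* = 1` makes the system infeasible;
(2) if `t* = 2` then every feasible solution has `α_{i1} = 1`; (3) if `t* = 3` then
every feasible solution has `α_{i1} = 0`.  (Here `α 0` is the paper's `α_{i1}`, the
value at the root node.) -/
theorem reduction_coordinate_cases (α β : Fin 7 → ℝ) (tstar : ℕ)
    (htstar : tstar ∈ ({1, 2, 3} : Set ℕ))
    (hcon : coordConstraints7 α β)
    (hαna : nonanticip7 tstar α) (hβna : nonanticip7 tstar β) :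
    (tstar = 1 → False) ∧
    (tstar = 2 → α 0 = 1) ∧
    (tstar = 3 → α 0 = 0) := by
  obtain ⟨h1, h2, h3, h4, h5, h6⟩ := hcon
  refine ⟨?_, ?_, ?_⟩
  · rintro rfl
    have key : ∀ v : Fin 7 → ℝ, nonanticip7 1 v → v 1 = v 2 ∧ v 3 = v 4 := by
      intro v hv
      exact ⟨hv.2 0 (by simp [stage7]) 1 2 ⟨1, by simp [parent7]⟩ ⟨1, by simp [parent7]⟩
          (by simp [stage7]),
        hv.2 0 (by simp [stage7]) 3 4 ⟨2, by simp [parent7]⟩ ⟨2, by simp [parent7]⟩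
          (by simp [stage7])⟩
    obtain ⟨a1, a2⟩ := key α hαna
    obtain ⟨b1, b2⟩ := key β hβna
    linarith
  · rintro rfl
    have key : ∀ v : Fin 7 → ℝ, nonanticip7 2 v → v 3 = v 4 := by
      intro v hv
      exact hv.2 1 (by simp [stage7]) 3 4 ⟨1, by simp [parent7]⟩ ⟨1, by simp [parent7]⟩
          (by simp [stage7])
    have a := key α hαna
    have b := key β hβna
    linarith
  · rintro rfl
    have key : ∀ v : Fin 7 → ℝ, nonanticip7 3 v → v 1 = v 2 := by
      intro v hv
      exact hv.1 1 2 (by simp [stage7]) (by simp [stage7])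
    have a := key α hαna
    have b := key β hβna
    linarith

end
end

section
/- Let 𝒯' be a finite rooted tree with node set V, and let P(n) denote the set of nodes on the unique path from the root to n (inclusive). Then the 0–1 matrix M ∈ {0,1}^{V×V} defined by M_{n,j} = 1 if and only if j ∈ P(n) (equivalently, n lies in the subtree rooted at j) is totally unimodular, i.e., every square submatrix of M has determinant in {−1, 0, 1}. -/
open scoped Classical

noncomputable section

/-- A finite rooted tree, given by a finite node type together with a root and an
ancestor (parent) map under which every node eventually reaches the root. -/
structure FiniteRootedTree (Node : Type) [Fintype Node] where
  root : Node
  parent : Node → Node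
  parent_root : parent root = root
  reaches_root : ∀ n, ∃ k : ℕ, parent^[k] n = root
  parent_acyclic : ∀ n, n ≠ root → parent n ≠ n

namespace FiniteRootedTree

variable {Node : Type} [Fintype Node]

/-- `j ∈ P(n)`: node `j` lies on the unique path from the root to `n` (i.e. `j` is an
ancestor of `n` or `n` itself); equivalently `n` lies in the subtree rooted at `j`. -/
def onPath (tr : FiniteRootedTree Node) (j n : Node) : Prop :=
  ∃ k : ℕ, tr.parent^[k] n = j

end FiniteRootedTree

/-- A square 0-1 matrix whose column supports form a laminar family has determinant
in `{-1, 0, 1}`. -/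
theorem laminar_det (k : ℕ) : ∀ (P : Fin k → Fin k → Prop),
    (∀ j l, (∀ i, P i j → P i l) ∨ (∀ i, P i l → P i j) ∨ (∀ i, P i j → ¬ P i l)) →
    (Matrix.of (fun i j => if P i j then (1 : ℝ) else 0)).det ∈ ({-1, 0, 1} : Set ℝ) := by
  induction k with
  | zero => intro P _; simp
  | succ k ih =>
    intro P hP
    by_cases hne : ∃ j, P 0 j
    · obtain ⟨j1, hj1⟩ := hne
      obtain ⟨j0, hj0, hmin⟩ := Finset.exists_min_image
        (Finset.univ.filter (fun j => P 0 j))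
        (fun j => (Finset.univ.filter (fun i => P i j)).card) ⟨j1, by simp [hj1]⟩
      simp only [Finset.mem_filter, Finset.mem_univ, true_and] at hj0 hmin
      have hsub : ∀ j, P 0 j → ∀ i, P i j0 → P i j := by
        intro j hj
        rcases hP j0 j with h | h | h
        · exact h
        · have hs : Finset.univ.filter (fun i => P i j) ⊆
              Finset.univ.filter (fun i => P i j0) := by
            intro i; simpa using h i
          have he := Finset.eq_of_subset_of_card_le hs (hmin j hj)
          intro i hi
          have : i ∈ Finset.univ.filter (fun i => P i j0) := by simpa using hi
          rw [← he] at this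
          simpa using this
        · exact absurd hj (h 0 hj0)
      obtain ⟨Q, hQdef⟩ : ∃ Q : Fin (k+1) → Fin (k+1) → Prop,
          ∀ i j, Q i j ↔ (P i j ∧ ¬ (P 0 j ∧ j ≠ j0 ∧ P i j0)) := ⟨_, fun _ _ => Iff.rfl⟩
      have hdet : (Matrix.of (fun i j => if P i j then (1 : ℝ) else 0)).det =
          (Matrix.of (fun i j => if Q i j then (1 : ℝ) else 0)).det := by
        rw [← Matrix.det_transpose, ← Matrix.det_transpose (Matrix.of (fun i j => if Q i j then (1 : ℝ) else 0))]
        refine Matrix.det_eq_of_forall_row_eq_smul_add_const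
          (fun j => if P 0 j ∧ j ≠ j0 then 1 else 0) j0 (by simp) ?_
        intro j i
        have := hsub j
        simp only [Matrix.transpose_apply, Matrix.of_apply, hQdef]
        by_cases h1 : P 0 j <;> by_cases h2 : j = j0 <;> by_cases h3 : P i j0 <;>
          by_cases h4 : P i j <;> simp_all
      have hQ0 : ∀ j, j ≠ j0 → ¬ Q 0 j := by
        intro j hj h
        rw [hQdef] at h
        exact h.2 ⟨h.1, hj, hj0⟩
      have hQ00 : Q 0 j0 := (hQdef _ _).2 ⟨hj0, by simp⟩
      have hQ : ∀ j l, j ≠ j0 → l ≠ j0 →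
          (∀ i, Q i j → Q i l) ∨ (∀ i, Q i l → Q i j) ∨ (∀ i, Q i j → ¬ Q i l) := by
        intro j l hj hl
        have a := hP j l
        have b := hP j j0
        have c := hP l j0
        have d := hsub j
        have e := hsub l
        simp only [hQdef]
        by_cases h1 : P 0 j <;> by_cases h2 : P 0 l <;> grind
      rw [hdet, Matrix.det_succ_row _ 0, Finset.sum_eq_single j0]
      · have := ih (fun i j => Q (Fin.succ i) (j0.succAbove j)) (by
          intro j l
          have := hQ (j0.succAbove j) (j0.succAbove l) (Fin.succAbove_ne _ _)
            (Fin.succAbove_ne _ _)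
          rcases this with h | h | h
          · exact Or.inl fun i => h _
          · exact Or.inr (Or.inl fun i => h _)
          · exact Or.inr (Or.inr fun i => h _))
        have he : (Matrix.of (fun i j => if Q i j then (1 : ℝ) else 0)).submatrix
            (Fin.succAbove 0) j0.succAbove =
            Matrix.of (fun i j => if Q (Fin.succ i) (j0.succAbove j) then (1 : ℝ) else 0) := by
          ext i j; simp
        rw [he]
        simp only [Matrix.of_apply, hQ00, if_true, mul_one]
        rcases neg_one_pow_eq_or ℝ ((0 : Fin (k+1)) + (j0 : ℕ) : ℕ) with h | h <;> rw [h] <;>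
          simp only [Set.mem_insert_iff, Set.mem_singleton_iff] at this ⊢ <;>
          rcases this with h | h | h <;> rw [h] <;> norm_num
      · intro j _ hj
        simp [hQ0 j hj]
      · simp
    · have : (Matrix.of (fun i j => if P i j then (1 : ℝ) else 0)).det = 0 := by
        apply Matrix.det_eq_zero_of_row_eq_zero 0
        intro j
        have : ¬ P 0 j := fun h => hne ⟨j, h⟩
        simp [this]
      rw [this]; simp

/-- **Proposition 2 (total unimodularity)**: for a finite rooted tree, the 0–1 matrix
`M` with `M_{n,j} = 1` iff `j` lies on the root path `P(n)` (equivalently, `n` belongs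
to the subtree rooted at `j`) is totally unimodular: every square submatrix has
determinant in `{−1, 0, 1}`. -/
theorem pathIncidenceMatrix_totallyUnimodular
    {Node : Type} [Fintype Node] [DecidableEq Node]
    (tr : FiniteRootedTree Node)
    (M : Matrix Node Node ℝ)
    (hM : ∀ n j, M n j = if tr.onPath j n then 1 else 0) :
    ∀ (k : ℕ) (r c : Fin k → Node), Function.Injective r → Function.Injective c →
      (M.submatrix r c).det ∈ ({-1, 0, 1} : Set ℝ) := by
  intro k r c _ _
  have he : M.submatrix r c =
      Matrix.of (fun i j => if tr.onPath (c j) (r i) then (1 : ℝ) else 0) := by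
    ext i j; simp [hM]
  rw [he]
  have key : ∀ a b : Node, ∀ n p q, p ≤ q → tr.parent^[p] n = a → tr.parent^[q] n = b →
      ∀ m, tr.onPath a m → tr.onPath b m := by
    rintro a b n p q hpq ha hb m ⟨t, ht⟩
    refine ⟨(q - p) + t, ?_⟩
    rw [Function.iterate_add_apply, ht, ← ha, ← Function.iterate_add_apply,
      Nat.sub_add_cancel hpq, hb]
  convert laminar_det k (fun i j => tr.onPath (c j) (r i)) ?_
  intro j l
  by_cases h : ∃ i, tr.onPath (c j) (r i) ∧ tr.onPath (c l) (r i)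
  · obtain ⟨i, ⟨p, hp⟩, ⟨q, hq⟩⟩ := h
    rcases le_total p q with hpq | hpq
    · exact Or.inl fun i' => key _ _ _ p q hpq hp hq _
    · exact Or.inr (Or.inl fun i' => key _ _ _ q p hpq hq hp _)
  · exact Or.inr (Or.inr fun i h1 h2 => h ⟨i, h1, h2⟩)

end
end

section
/- For the single-resource capacity expansion problem on a scenario tree 𝒯 with T stages and a revision time t* ∈ {1,…,T}, the following bounds hold for the difference between the two-stage LP value v^T and the adaptive two-stage LP value v^R(t*): a_* δ* − (ā^−(t*) − ā^+(t*)) δ^−(t*) − ā^+(t*) δ^+(t*) ≤ v^T − v^R(t*) ≤ a^* δ* − (a̲^−(t*) − a̲^+(t*)) δ^−(t*) − a̲^+(t*) δ^+(t*). -/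
open scoped Classical

noncomputable section

/-- A scenario tree with `T` stages over a finite node type: a finite rooted tree whose
nodes are partitioned into stages `1, …, T` (the root being the unique stage-1 node),
equipped with strictly positive node probabilities summing to one within each stage and
with each internal node's probability equal to the sum of its children's probabilities. -/
structure ScenarioTree (T : ℕ) (Node : Type) [Fintype Node] [DecidableEq Node] where
  root : Node
  parent : Node → Node
  stage : Node → ℕ
  stage_root : stage root = 1
  stage_pos : ∀ n, 1 ≤ stage n
  stage_le : ∀ n, stage n ≤ T
  root_unique : ∀ n, stage n = 1 → n = root
  parent_root : parent root = root
  parent_stage : ∀ n, n ≠ root → stage (parent n) + 1 = stage n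
  reaches_root : ∀ n, ∃ k : ℕ, parent^[k] n = root
  prob : Node → ℝ
  prob_pos : ∀ n, 0 < prob n
  prob_sum_stage : ∀ t, 1 ≤ t → t ≤ T →
    ∑ n ∈ Finset.univ.filter (fun n => stage n = t), prob n = 1
  prob_children : ∀ n, stage n < T →
    prob n = ∑ m ∈ Finset.univ.filter (fun m => m ≠ root ∧ parent m = n), prob m

namespace ScenarioTree

variable {T : ℕ} {Node : Type} [Fintype Node] [DecidableEq Node]

/-- `m` lies on the unique path from the root to `n` (i.e. `m` is an ancestor of `n`
or `n` itself); equivalently, `n` belongs to the subtree `𝒯(m)` rooted at `m`. -/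
def onPath (tr : ScenarioTree T Node) (m n : Node) : Prop :=
  ∃ k : ℕ, tr.parent^[k] n = m

/-- `P(n)`: the set of nodes on the unique path from the root to `n` (inclusive). -/
def pathSet (tr : ScenarioTree T Node) (n : Node) : Finset Node :=
  Finset.univ.filter fun m => tr.onPath m n

/-- `S_t`: the set of nodes in stage `t`. -/
def stageSet (tr : ScenarioTree T Node) (t : ℕ) : Finset Node :=
  Finset.univ.filter fun n => tr.stage n = t

/-- Objective `∑_{n ∈ 𝒯} p_n a_n x_n` of the single-resource capacity expansion LP. -/
def lpObj (tr : ScenarioTree T Node) (a x : Node → ℝ) : ℝ :=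
  ∑ n, tr.prob n * a n * x n

/-- Feasibility for the single-resource capacity expansion LP:
`x ≥ 0` and `∑_{m ∈ P(n)} x_m ≥ δ_n` for all nodes `n`. -/
def lpFeas (tr : ScenarioTree T Node) (δ x : Node → ℝ) : Prop :=
  (∀ n, 0 ≤ x n) ∧ ∀ n, δ n ≤ ∑ m ∈ tr.pathSet n, x m

/-- Two-stage constraint: `x_m = x_n` for all `m, n` in the same stage. -/
def twoStageConstr (tr : ScenarioTree T Node) (x : Node → ℝ) : Prop :=
  ∀ m n, tr.stage m = tr.stage n → x m = x n

/-- Adaptive two-stage constraint with revision time `t*`: `x_m = x_n` for all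
`m, n ∈ S_t` with `t < t*`, and `x_m = x_n` for all `m, n ∈ S_t ∩ 𝒯(j)` for each
`j ∈ S_{t*}` and each `t ≥ t*`. -/
def adaptiveConstr (tr : ScenarioTree T Node) (tstar : ℕ) (x : Node → ℝ) : Prop :=
  (∀ m n, tr.stage m = tr.stage n → tr.stage m < tstar → x m = x n) ∧
  (∀ j, tr.stage j = tstar → ∀ m n, tr.onPath j m → tr.onPath j n →
    tr.stage m = tr.stage n → x m = x n)

/-- `v^M`: optimal value of the multi-stage LP. -/
def vM (tr : ScenarioTree T Node) (a δ : Node → ℝ) : ℝ :=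
  sInf (tr.lpObj a '' {x | tr.lpFeas δ x})

/-- `v^T`: optimal value of the two-stage LP. -/
def vT (tr : ScenarioTree T Node) (a δ : Node → ℝ) : ℝ :=
  sInf (tr.lpObj a '' {x | tr.lpFeas δ x ∧ tr.twoStageConstr x})

/-- `v^R(t*)`: optimal value of the adaptive two-stage LP with revision time `t*`. -/
def vR (tr : ScenarioTree T Node) (a δ : Node → ℝ) (tstar : ℕ) : ℝ :=
  sInf (tr.lpObj a '' {x | tr.lpFeas δ x ∧ tr.adaptiveConstr tstar x})

/-- `a_* = min_{n∈𝒯} a_n`. -/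
def aMin (tr : ScenarioTree T Node) (a : Node → ℝ) : ℝ := sInf (Set.range a)

/-- `a^* = max_{n∈𝒯} a_n`. -/
def aMax (tr : ScenarioTree T Node) (a : Node → ℝ) : ℝ := sSup (Set.range a)

/-- `δ* = max_{n∈𝒯} δ_n`. -/
def deltaMax (tr : ScenarioTree T Node) (δ : Node → ℝ) : ℝ := sSup (Set.range δ)

/-- `a̲^−(t*) = min{a_n : t_n < t*}`. -/
def aMinusLo (tr : ScenarioTree T Node) (a : Node → ℝ) (tstar : ℕ) : ℝ :=
  sInf (a '' {n | tr.stage n < tstar})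

/-- `a̲^+(t*) = min{a_n : t_n ≥ t*}`. -/
def aPlusLo (tr : ScenarioTree T Node) (a : Node → ℝ) (tstar : ℕ) : ℝ :=
  sInf (a '' {n | tstar ≤ tr.stage n})

/-- `ā^−(t*) = max{a_n : t_n < t*}`. -/
def aMinusHi (tr : ScenarioTree T Node) (a : Node → ℝ) (tstar : ℕ) : ℝ :=
  sSup (a '' {n | tr.stage n < tstar})

/-- `ā^+(t*) = max{a_n : t_n ≥ t*}`. -/
def aPlusHi (tr : ScenarioTree T Node) (a : Node → ℝ) (tstar : ℕ) : ℝ :=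
  sSup (a '' {n | tstar ≤ tr.stage n})

/-- `δ^−(t*) = max_{m ∈ 𝒯(1, t*−1)} δ_m`, the maximum demand before the revision time. -/
def deltaMinus (tr : ScenarioTree T Node) (δ : Node → ℝ) (tstar : ℕ) : ℝ :=
  sSup (δ '' {m | tr.stage m < tstar})

/-- `δ^+(t*) = ∑_{n ∈ S_{t*}} p_n · max_{m ∈ 𝒯(1, t*−1) ∪ 𝒯(n)} δ_m`. -/
def deltaPlus (tr : ScenarioTree T Node) (δ : Node → ℝ) (tstar : ℕ) : ℝ :=
  ∑ n ∈ tr.stageSet tstar, tr.prob n *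
    sSup (δ '' {m | tr.stage m < tstar ∨ tr.onPath n m})

/-- `δ̄ = ∑_{n ∈ S_T} p_n · max_{m ∈ P(n)} δ_m`, the expected maximum demand over scenarios. -/
def deltaBar (tr : ScenarioTree T Node) (δ : Node → ℝ) : ℝ :=
  ∑ n ∈ tr.stageSet T, tr.prob n * sSup (δ '' {m | tr.onPath m n})

end ScenarioTree


namespace ScenarioTree

variable {T : ℕ} {Node : Type} [Fintype Node] [DecidableEq Node]

lemma stage_iter (tr : ScenarioTree T Node) : ∀ (k : ℕ) (n : Node), k < tr.stage n →
    tr.stage (tr.parent^[k] n) + k = tr.stage n := by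
  intro k
  induction k with
  | zero => intro n _; simp
  | succ k ih =>
    intro n hn
    have hne : n ≠ tr.root := by
      rintro rfl
      rw [tr.stage_root] at hn; omega
    have h := tr.parent_stage n hne
    have := ih (tr.parent n) (by omega)
    rw [Function.iterate_succ_apply]
    omega

lemma iter_root (tr : ScenarioTree T Node) (k : ℕ) : tr.parent^[k] tr.root = tr.root :=
  Function.iterate_fixed tr.parent_root k

lemma iter_big (tr : ScenarioTree T Node) (k : ℕ) (n : Node) (h : tr.stage n ≤ k + 1) :
    tr.parent^[k] n = tr.root := by
  have hp := tr.stage_pos n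
  have h0 : tr.parent^[tr.stage n - 1] n = tr.root := by
    apply tr.root_unique
    have := tr.stage_iter (tr.stage n - 1) n (by omega)
    omega
  have : k = (k - (tr.stage n - 1)) + (tr.stage n - 1) := by omega
  rw [this, Function.iterate_add_apply, h0, iter_root]

lemma onPath_iff (tr : ScenarioTree T Node) (m n : Node) :
    tr.onPath m n ↔ tr.stage m ≤ tr.stage n ∧ tr.parent^[tr.stage n - tr.stage m] n = m := by
  constructor
  · rintro ⟨k, rfl⟩
    by_cases hk : k < tr.stage n
    · have := tr.stage_iter k n hk
      refine ⟨by omega, ?_⟩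
      congr 2; omega
    · have h := tr.iter_big k n (by omega)
      have hp := tr.stage_pos n
      rw [h, tr.stage_root]
      exact ⟨hp, tr.iter_big _ _ (by omega)⟩
  · rintro ⟨_, h⟩
    exact ⟨_, h⟩

lemma onPath_refl (tr : ScenarioTree T Node) (n : Node) : tr.onPath n n := ⟨0, rfl⟩

lemma onPath_trans (tr : ScenarioTree T Node) {l m n : Node} (h : tr.onPath l m)
    (h' : tr.onPath m n) : tr.onPath l n := by
  obtain ⟨k, rfl⟩ := h
  obtain ⟨j, rfl⟩ := h'
  exact ⟨k + j, Function.iterate_add_apply _ _ _ _⟩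

lemma onPath_root (tr : ScenarioTree T Node) (n : Node) : tr.onPath tr.root n :=
  tr.reaches_root n

lemma onPath_stage_le (tr : ScenarioTree T Node) {m n : Node} (h : tr.onPath m n) :
    tr.stage m ≤ tr.stage n := ((tr.onPath_iff m n).1 h).1

lemma onPath_unique (tr : ScenarioTree T Node) {m m' n : Node} (h : tr.onPath m n)
    (h' : tr.onPath m' n) (hs : tr.stage m = tr.stage m') : m = m' := by
  rw [onPath_iff] at h h'
  rw [← h.2, ← h'.2, hs]

/-- The ancestor of `n` in stage `t`. -/
def anc (tr : ScenarioTree T Node) (n : Node) (t : ℕ) : Node := tr.parent^[tr.stage n - t] n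

lemma anc_onPath (tr : ScenarioTree T Node) (n : Node) (t : ℕ) : tr.onPath (tr.anc n t) n :=
  ⟨_, rfl⟩

lemma anc_stage (tr : ScenarioTree T Node) (n : Node) (t : ℕ) (h1 : 1 ≤ t)
    (h2 : t ≤ tr.stage n) : tr.stage (tr.anc n t) = t := by
  have := tr.stage_iter (tr.stage n - t) n (by omega)
  unfold anc
  omega

lemma anc_eq (tr : ScenarioTree T Node) {m n : Node} (h : tr.onPath m n) :
    tr.anc n (tr.stage m) = m := ((tr.onPath_iff m n).1 h).2

lemma onPath_of_le (tr : ScenarioTree T Node) {m m' n : Node} (h : tr.onPath m n)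
    (h' : tr.onPath m' n) (hs : tr.stage m ≤ tr.stage m') : tr.onPath m m' := by
  have hx : tr.onPath (tr.anc m' (tr.stage m)) n := tr.onPath_trans (tr.anc_onPath _ _) h'
  have hst := tr.anc_stage m' (tr.stage m) (tr.stage_pos m) hs
  have := tr.onPath_unique hx h hst
  rw [← this]
  exact tr.anc_onPath _ _

lemma mem_pathSet (tr : ScenarioTree T Node) (m n : Node) :
    m ∈ tr.pathSet n ↔ tr.onPath m n := by simp [pathSet]

/-- Path sums are monotone along stages for functions agreeing stagewise. -/
lemma pathSum_le (tr : ScenarioTree T Node) (f g : Node → ℝ) (n n' : Node)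
    (hs : tr.stage n ≤ tr.stage n') (hg : ∀ m, 0 ≤ g m)
    (hfg : ∀ m m', tr.onPath m n → tr.onPath m' n' → tr.stage m = tr.stage m' → f m ≤ g m') :
    ∑ m ∈ tr.pathSet n, f m ≤ ∑ m ∈ tr.pathSet n', g m := by
  have hle : ∀ m ∈ tr.pathSet n, tr.stage m ≤ tr.stage n' := fun m hm =>
    (tr.onPath_stage_le ((tr.mem_pathSet m n).1 hm)).trans hs
  have hst : ∀ m ∈ tr.pathSet n, tr.stage (tr.anc n' (tr.stage m)) = tr.stage m := fun m hm =>
    tr.anc_stage _ _ (tr.stage_pos m) (hle m hm)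
  calc ∑ m ∈ tr.pathSet n, f m ≤ ∑ m ∈ tr.pathSet n, g (tr.anc n' (tr.stage m)) := by
        apply Finset.sum_le_sum
        intro m hm
        exact hfg _ _ ((tr.mem_pathSet m n).1 hm) (tr.anc_onPath _ _) (hst m hm).symm
    _ = ∑ m ∈ (tr.pathSet n).image (fun m => tr.anc n' (tr.stage m)), g m := by
        rw [Finset.sum_image]
        intro m hm m' hm' h
        have h3 := hst m hm
        have h4 := hst m' hm'
        simp only at h
        rw [h] at h3
        exact tr.onPath_unique ((tr.mem_pathSet _ _).1 hm) ((tr.mem_pathSet _ _).1 hm')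
          (h3.symm.trans h4)
    _ ≤ ∑ m ∈ tr.pathSet n', g m := by
        apply Finset.sum_le_sum_of_subset_of_nonneg
        · intro m hm
          obtain ⟨k, _, rfl⟩ := Finset.mem_image.1 hm
          exact (tr.mem_pathSet _ _).2 (tr.anc_onPath _ _)
        · intro m _ _; exact hg m

lemma mem_stageSet (tr : ScenarioTree T Node) (n : Node) (t : ℕ) :
    n ∈ tr.stageSet t ↔ tr.stage n = t := by simp [stageSet]

lemma leaf_prob (tr : ScenarioTree T Node) : ∀ (d : ℕ) (n : Node), tr.stage n + d = T →
    ∑ l ∈ (tr.stageSet T).filter (fun l => tr.onPath n l), tr.prob l = tr.prob n := by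
  intro d
  induction d with
  | zero =>
    intro n hn
    have : (tr.stageSet T).filter (fun l => tr.onPath n l) = {n} := by
      ext l
      simp only [Finset.mem_filter, mem_stageSet, Finset.mem_singleton]
      constructor
      · rintro ⟨h, h'⟩
        exact (tr.onPath_unique h' (tr.onPath_refl l) (by omega)).symm
      · rintro rfl
        exact ⟨by omega, tr.onPath_refl _⟩
    rw [this, Finset.sum_singleton]
  | succ d ih =>
    intro n hn
    rw [tr.prob_children n (by omega)]
    rw [← Finset.sum_fiberwise_of_maps_to (g := fun l => tr.anc l (tr.stage n + 1))
      (t := Finset.univ.filter (fun m => m ≠ tr.root ∧ tr.parent m = n))]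
    · apply Finset.sum_congr rfl
      intro c hc
      simp only [Finset.mem_filter, Finset.mem_univ, true_and] at hc
      have hcs := tr.parent_stage c hc.1
      rw [hc.2] at hcs
      rw [← ih c (by omega)]
      apply Finset.sum_congr _ (fun _ _ => rfl)
      ext l
      simp only [Finset.mem_filter, mem_stageSet]
      constructor
      · rintro ⟨⟨h, h'⟩, h3⟩
        refine ⟨h, ?_⟩
        rw [← h3]; exact tr.anc_onPath _ _
      · rintro ⟨h, h'⟩
        refine ⟨⟨h, tr.onPath_trans ⟨1, by simpa using hc.2⟩ h'⟩, ?_⟩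
        rw [hcs]; exact tr.anc_eq h'
    · intro l hl
      simp only [Finset.mem_filter, mem_stageSet] at hl
      simp only [Finset.mem_filter, Finset.mem_univ, true_and]
      have hst := tr.anc_stage l (tr.stage n + 1) (by omega) (by omega)
      have hpos := tr.stage_pos n
      have hne : tr.anc l (tr.stage n + 1) ≠ tr.root := by
        intro h
        rw [h, tr.stage_root] at hst; omega
      refine ⟨hne, ?_⟩
      have h5 := tr.parent_stage _ hne
      apply tr.onPath_unique (n := l) _ hl.2 (by omega)
      exact tr.onPath_trans ⟨1, rfl⟩ (tr.anc_onPath l (tr.stage n + 1))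

/-- Expectation over nodes is expectation over scenarios of path sums. -/
lemma sum_eq_leaf (tr : ScenarioTree T Node) (g : Node → ℝ) :
    ∑ n, tr.prob n * g n = ∑ l ∈ tr.stageSet T, tr.prob l * ∑ m ∈ tr.pathSet l, g m := by
  have : ∀ n, tr.prob n * g n
      = ∑ l ∈ tr.stageSet T, if tr.onPath n l then tr.prob l * g n else 0 := by
    intro n
    have := tr.stage_le n
    rw [← tr.leaf_prob (T - tr.stage n) n (by omega), Finset.sum_mul, Finset.sum_filter]
  rw [Finset.sum_congr rfl (fun n _ => this n), Finset.sum_comm]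
  apply Finset.sum_congr rfl
  intro l _
  rw [pathSet, Finset.mul_sum, Finset.sum_filter]

lemma lpObj_eq (tr : ScenarioTree T Node) (a x : Node → ℝ) :
    tr.lpObj a x = ∑ l ∈ tr.stageSet T, tr.prob l * ∑ m ∈ tr.pathSet l, a m * x m := by
  rw [← sum_eq_leaf, lpObj]
  exact Finset.sum_congr rfl (fun _ _ => mul_assoc _ _ _)

lemma T_pos (tr : ScenarioTree T Node) : 1 ≤ T :=
  (tr.stage_pos tr.root).trans (tr.stage_le _)

lemma leaf_sum (tr : ScenarioTree T Node) : ∑ l ∈ tr.stageSet T, tr.prob l = 1 :=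
  tr.prob_sum_stage T tr.T_pos le_rfl

lemma bdd (f : Node → ℝ) (s : Set Node) : BddAbove (f '' s) ∧ BddBelow (f '' s) :=
  ⟨(Set.toFinite _).bddAbove, (Set.toFinite _).bddBelow⟩

lemma le_sup (f : Node → ℝ) (s : Set Node) {n : Node} (h : n ∈ s) : f n ≤ sSup (f '' s) :=
  le_csSup (bdd f s).1 ⟨n, h, rfl⟩

lemma inf_le (f : Node → ℝ) (s : Set Node) {n : Node} (h : n ∈ s) : sInf (f '' s) ≤ f n :=
  csInf_le (bdd f s).2 ⟨n, h, rfl⟩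

lemma sup_le (f : Node → ℝ) (s : Set Node) {b : ℝ} (hb : 0 ≤ b) (h : ∀ n ∈ s, f n ≤ b) :
    sSup (f '' s) ≤ b :=
  Real.sSup_le (by rintro _ ⟨n, hn, rfl⟩; exact h n hn) hb

lemma sup_nonneg (f : Node → ℝ) (s : Set Node) (h : ∀ n, 0 ≤ f n) : 0 ≤ sSup (f '' s) :=
  Real.sSup_nonneg (by rintro _ ⟨n, hn, rfl⟩; exact h n)

lemma inf_nonneg (f : Node → ℝ) (s : Set Node) (h : ∀ n, 0 ≤ f n) : 0 ≤ sInf (f '' s) :=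
  Real.sInf_nonneg (by rintro _ ⟨n, hn, rfl⟩; exact h n)

lemma lpObj_nonneg (tr : ScenarioTree T Node) (a x : Node → ℝ) (ha : ∀ n, 0 ≤ a n)
    (hx : ∀ n, 0 ≤ x n) : 0 ≤ tr.lpObj a x :=
  Finset.sum_nonneg fun n _ => mul_nonneg (mul_nonneg (tr.prob_pos n).le (ha n)) (hx n)

lemma pathSum_root_le (tr : ScenarioTree T Node) (x : Node → ℝ) (hx : ∀ n, 0 ≤ x n)
    {m n : Node} (h : tr.onPath m n) : x m ≤ ∑ k ∈ tr.pathSet n, x k :=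
  Finset.single_le_sum (f := x) (fun i _ => hx i) ((tr.mem_pathSet _ _).2 h)

lemma exists_leaf (tr : ScenarioTree T Node) : ∃ l, tr.stage l = T := by
  by_contra! h
  have h1 := tr.leaf_sum
  have : tr.stageSet T = ∅ := by
    ext l; simp [mem_stageSet, h l]
  simp [this] at h1

/-- Two-stage feasible solutions cost at least `a_* δ*`. -/
lemma twoStage_lower (tr : ScenarioTree T Node) (a δ x : Node → ℝ) (ha : ∀ n, 0 ≤ a n)
    (hx : tr.lpFeas δ x) (hc : tr.twoStageConstr x) :
    tr.aMin a * tr.deltaMax δ ≤ tr.lpObj a x := by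
  unfold aMin deltaMax
  rw [← Set.image_univ, ← Set.image_univ]
  rw [lpObj_eq]
  have key : ∀ l ∈ tr.stageSet T, tr.prob l * (sInf (a '' Set.univ) * sSup (δ '' Set.univ))
      ≤ tr.prob l * ∑ m ∈ tr.pathSet l, a m * x m := by
    intro l hl
    rw [mem_stageSet] at hl
    apply mul_le_mul_of_nonneg_left _ (tr.prob_pos l).le
    calc sInf (a '' Set.univ) * sSup (δ '' Set.univ)
        ≤ sInf (a '' Set.univ) * ∑ m ∈ tr.pathSet l, x m := by
          apply mul_le_mul_of_nonneg_left _ (inf_nonneg _ _ ha)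
          apply sup_le _ _ (Finset.sum_nonneg fun i _ => hx.1 i)
          intro n _
          refine (hx.2 n).trans ?_
          apply tr.pathSum_le _ _ _ _ (by rw [hl]; exact tr.stage_le n) hx.1
          intro m m' _ _ hs
          exact (hc m m' hs).le
      _ = ∑ m ∈ tr.pathSet l, sInf (a '' Set.univ) * x m := Finset.mul_sum _ _ _
      _ ≤ _ := Finset.sum_le_sum fun m _ =>
          mul_le_mul_of_nonneg_right (inf_le _ _ trivial) (hx.1 m)
  have := Finset.sum_le_sum key
  rwa [← Finset.sum_mul, leaf_sum, one_mul] at this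

lemma exists_twoStage (tr : ScenarioTree T Node) (δ : Node → ℝ) (hδ : ∀ n, 0 ≤ δ n) :
    ∃ x, tr.lpFeas δ x ∧ tr.twoStageConstr x := by
  have hn : ∀ n, 0 ≤ (fun _ => sSup (δ '' Set.univ) : Node → ℝ) n :=
    fun _ => sup_nonneg _ _ hδ
  refine ⟨fun _ => sSup (δ '' Set.univ), ⟨hn, ?_⟩, fun _ _ _ => rfl⟩
  intro n
  exact (le_sup δ Set.univ (n := n) trivial).trans
    (tr.pathSum_root_le (fun _ => sSup (δ '' Set.univ)) hn (tr.onPath_refl n))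

/-- A good adaptive solution. -/
lemma adaptive_upper (tr : ScenarioTree T Node) (a δ : Node → ℝ) (ha : ∀ n, 0 ≤ a n)
    (hδ : ∀ n, 0 ≤ δ n) (t : ℕ) (h1 : 1 ≤ t) (h2 : t ≤ T) :
    ∃ x, (tr.lpFeas δ x ∧ tr.adaptiveConstr t x) ∧
      tr.lpObj a x ≤ (tr.aMinusHi a t - tr.aPlusHi a t) * tr.deltaMinus δ t
        + tr.aPlusHi a t * tr.deltaPlus δ t := by
  set D : Node → ℝ := fun n => sSup (δ '' {m | tr.stage m < t ∨ tr.onPath n m}) with hD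
  have hm0 : 0 ≤ tr.deltaMinus δ t := sup_nonneg _ _ hδ
  have hD0 : ∀ n, 0 ≤ D n := fun n => sup_nonneg _ _ hδ
  have hDm : ∀ n, tr.deltaMinus δ t ≤ D n := fun n =>
    sup_le _ _ (hD0 n) (fun m hm => le_sup _ _ (Or.inl hm))
  set u : Node → ℝ := fun n => if n = tr.root then tr.deltaMinus δ t else 0 with hu
  set w : Node → ℝ := fun n => if tr.stage n = t then D n - tr.deltaMinus δ t else 0 with hw
  have hu0 : ∀ n, 0 ≤ u n := by
    intro n; simp only [hu]; split_ifs <;> simp [hm0]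
  have hw0 : ∀ n, 0 ≤ w n := by
    intro n; simp only [hw]; split_ifs <;> simp [hDm]
  have hur : u tr.root = tr.deltaMinus δ t := by simp [hu]
  refine ⟨fun n => u n + w n, ⟨⟨fun n => add_nonneg (hu0 n) (hw0 n), ?_⟩, ?_, ?_⟩, ?_⟩
  · intro n
    rw [Finset.sum_add_distrib]
    have hU := tr.pathSum_root_le u hu0 (tr.onPath_root n)
    rw [hur] at hU
    by_cases hn : tr.stage n < t
    · have hW : 0 ≤ ∑ k ∈ tr.pathSet n, w k := Finset.sum_nonneg fun i _ => hw0 i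
      have : δ n ≤ tr.deltaMinus δ t := le_sup δ {m | tr.stage m < t} hn
      linarith
    · have hW := tr.pathSum_root_le w hw0 (tr.anc_onPath n t)
      have hs := tr.anc_stage n t h1 (by omega)
      have hwv : w (tr.anc n t) = D (tr.anc n t) - tr.deltaMinus δ t := by simp [hw, hs]
      have : δ n ≤ D (tr.anc n t) :=
        le_sup δ {m | tr.stage m < t ∨ tr.onPath (tr.anc n t) m} (Or.inr (tr.anc_onPath n t))
      linarith
  · intro m n hmn hlt
    have e : m = tr.root ↔ n = tr.root := by
      constructor
      · intro h; apply tr.root_unique; rw [← hmn, h, tr.stage_root]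
      · intro h; apply tr.root_unique; rw [hmn, h, tr.stage_root]
    have w1 : w m = 0 := by simp only [hw]; rw [if_neg (by omega)]
    have w2 : w n = 0 := by simp only [hw]; rw [if_neg (by omega)]
    simp only [w1, w2, hu, e]
  · intro j hj m n hm hn hmn
    by_cases hmt : tr.stage m = t
    · have e1 : m = j := tr.onPath_unique (tr.onPath_refl m) hm (by omega)
      have e2 : n = j := tr.onPath_unique (tr.onPath_refl n) hn (by omega)
      rw [e1, e2]
    · have e : m = tr.root ↔ n = tr.root := by
        constructor
        · intro h; apply tr.root_unique; rw [← hmn, h, tr.stage_root]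
        · intro h; apply tr.root_unique; rw [hmn, h, tr.stage_root]
      have w1 : w m = 0 := by simp only [hw]; rw [if_neg (by omega)]
      have w2 : w n = 0 := by simp only [hw]; rw [if_neg (by omega)]
      simp only [w1, w2, hu, e]
  · have hroot : tr.prob tr.root = 1 := by
      have := tr.prob_sum_stage 1 le_rfl tr.T_pos
      have e : Finset.univ.filter (fun n => tr.stage n = 1) = {tr.root} := by
        ext n
        simp only [Finset.mem_filter, Finset.mem_univ, true_and, Finset.mem_singleton]
        exact ⟨tr.root_unique n, fun h => by rw [h, tr.stage_root]⟩
      rwa [e, Finset.sum_singleton] at this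
    have hA : ∑ n, tr.prob n * a n * u n = a tr.root * tr.deltaMinus δ t := by
      rw [Finset.sum_eq_single tr.root]
      · rw [hroot, hur, one_mul]
      · intro b _ hb; simp [hu, hb]
      · simp
    have hA' : a tr.root * tr.deltaMinus δ t ≤ tr.aMinusHi a t * tr.deltaMinus δ t := by
      by_cases ht : 1 < t
      · apply mul_le_mul_of_nonneg_right _ hm0
        exact le_sup a {n | tr.stage n < t} (by simpa [tr.stage_root] using ht)
      · have : tr.deltaMinus δ t = 0 := by
          apply le_antisymm _ hm0
          apply sup_le _ _ le_rfl
          intro n hn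
          have h3 : tr.stage n < t := hn
          have := tr.stage_pos n
          omega
        simp [this]
    have hps : ∑ n ∈ tr.stageSet t, tr.prob n = 1 := tr.prob_sum_stage t h1 h2
    have hB : ∑ n, tr.prob n * a n * w n
        ≤ tr.aPlusHi a t * (tr.deltaPlus δ t - tr.deltaMinus δ t) := by
      have e : tr.aPlusHi a t * (tr.deltaPlus δ t - tr.deltaMinus δ t)
          = ∑ n, tr.prob n * tr.aPlusHi a t * w n := by
        have e1 : tr.deltaMinus δ t = ∑ n ∈ tr.stageSet t, tr.prob n * tr.deltaMinus δ t := by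
          rw [← Finset.sum_mul, hps, one_mul]
        have e2 : tr.deltaPlus δ t - tr.deltaMinus δ t
            = ∑ n ∈ tr.stageSet t, tr.prob n * (D n - tr.deltaMinus δ t) := by
          simp only [mul_sub]
          rw [Finset.sum_sub_distrib, ← e1]
          rfl
        rw [e2, Finset.mul_sum, stageSet, Finset.sum_filter]
        apply Finset.sum_congr rfl
        intro n _
        simp only [hw]
        split_ifs
        · ring
        · simp
      rw [e]
      apply Finset.sum_le_sum
      intro n _
      by_cases hn : tr.stage n = t
      · apply mul_le_mul_of_nonneg_right _ (hw0 n)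
        apply mul_le_mul_of_nonneg_left _ (tr.prob_pos n).le
        exact le_sup a {n | t ≤ tr.stage n} hn.ge
      · simp [hw, hn]
    have : tr.lpObj a (fun n => u n + w n)
        = ∑ n, tr.prob n * a n * u n + ∑ n, tr.prob n * a n * w n := by
      rw [lpObj, ← Finset.sum_add_distrib]
      exact Finset.sum_congr rfl (fun _ _ => mul_add _ _ _)
    rw [this]
    linarith

/-- From an adaptive solution, build a two-stage solution of controlled cost. -/
lemma adaptive_to_twoStage (tr : ScenarioTree T Node) (a δ x : Node → ℝ) (ha : ∀ n, 0 ≤ a n)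
    (hδ : ∀ n, 0 ≤ δ n) (t : ℕ) (h1 : 1 ≤ t) (h2 : t ≤ T)
    (hx : tr.lpFeas δ x) (hc : tr.adaptiveConstr t x) :
    ∃ y, (tr.lpFeas δ y ∧ tr.twoStageConstr y) ∧
      tr.lpObj a y ≤ tr.lpObj a x + (tr.aMax a * tr.deltaMax δ
        - (tr.aMinusLo a t - tr.aPlusLo a t) * tr.deltaMinus δ t
        - tr.aPlusLo a t * tr.deltaPlus δ t) := by
  have hMa : tr.aMax a = sSup (a '' Set.univ) := by rw [aMax, Set.image_univ]
  have hMd : tr.deltaMax δ = sSup (δ '' Set.univ) := by rw [deltaMax, Set.image_univ]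
  set A := tr.aMax a with hA
  set M := tr.deltaMax δ with hM
  have hAle : ∀ n, a n ≤ A := fun n => hMa ▸ le_sup a Set.univ trivial
  have hMle : ∀ n, δ n ≤ M := fun n => hMd ▸ le_sup δ Set.univ trivial
  have hA0 : 0 ≤ A := (ha tr.root).trans (hAle _)
  have hM0 : 0 ≤ M := (hδ tr.root).trans (hMle _)
  set D : Node → ℝ := fun n => sSup (δ '' {m | tr.stage m < t ∨ tr.onPath n m}) with hD
  have hD0 : ∀ n, 0 ≤ D n := fun n => sup_nonneg _ _ hδ
  set dm := tr.deltaMinus δ t with hdm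
  have hm0 : 0 ≤ dm := sup_nonneg _ _ hδ
  have hDm : ∀ n, dm ≤ D n := fun n =>
    sup_le _ _ (hD0 n) (fun m hm => le_sup _ _ (Or.inl hm))
  have hDM : ∀ n, D n ≤ M := fun n => sup_le _ _ hM0 (fun m _ => hMle m)
  set cm := tr.aMinusLo a t with hcm
  set cp := tr.aPlusLo a t with hcp
  have hcp0 : 0 ≤ cp := inf_nonneg _ _ ha
  have hcmA : cm ≤ A := by
    by_cases ht : 1 < t
    · exact (inf_le a {n | tr.stage n < t} (n := tr.root)
        (by simpa [tr.stage_root] using ht)).trans (hAle _)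
    · have : {n | tr.stage n < t} = ∅ := by
        ext n
        have := tr.stage_pos n
        simp only [Set.mem_ofPred_eq, Set.mem_empty_iff_false, iff_false]
        omega
      rw [hcm, aMinusLo, this]; simpa using hA0
  obtain ⟨l0, hl0⟩ := tr.exists_leaf
  have hcpA : cp ≤ A := (inf_le a {n | t ≤ tr.stage n} (n := l0)
        (by simpa [hl0] using h2)).trans (hAle _)
  set xm : Node → ℝ := fun n => if tr.stage n < t then x n else 0 with hxm
  set xp : Node → ℝ := fun n => if tr.stage n < t then 0 else x n with hxp
  have hxm0 : ∀ n, 0 ≤ xm n := by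
    intro n; simp only [hxm]; split_ifs; exacts [hx.1 n, le_rfl]
  have hxp0 : ∀ n, 0 ≤ xp n := by
    intro n; simp only [hxp]; split_ifs; exacts [le_rfl, hx.1 n]
  have hxs : ∀ n, x n = xm n + xp n := by
    intro n; simp only [hxm, hxp]; split_ifs <;> simp
  have hxmc : ∀ m n, tr.stage m = tr.stage n → xm m = xm n := by
    intro m n h
    simp only [hxm, h]
    split_ifs with h3
    · exact hc.1 m n h (by omega)
    · rfl
  set X := ∑ m ∈ tr.pathSet l0, xm m with hX
  have hXall : ∀ n, t ≤ tr.stage n + 1 → ∑ m ∈ tr.pathSet n, xm m = X := by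
    intro n hn
    apply le_antisymm
    · apply tr.pathSum_le _ _ _ _ (by rw [hl0]; exact tr.stage_le n) hxm0
      intro m m' _ _ h; exact (hxmc m m' h).le
    · -- restrict to stages below `t`
      rw [hX]
      have e : ∑ m ∈ tr.pathSet l0, xm m
          ≤ ∑ m ∈ tr.pathSet (tr.anc l0 (tr.stage n)), xm m := by
        have hs := tr.anc_stage l0 (tr.stage n) (tr.stage_pos n) (by
          rw [hl0]; exact tr.stage_le n)
        have hsub : tr.pathSet (tr.anc l0 (tr.stage n)) ⊆ tr.pathSet l0 := by
          intro m hm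
          rw [mem_pathSet] at hm ⊢
          exact tr.onPath_trans hm (tr.anc_onPath _ _)
        apply le_of_eq
        symm
        apply Finset.sum_subset hsub
        intro m hm hm'
        rw [mem_pathSet] at hm hm'
        simp only [hxm]
        rw [if_neg]
        intro hlt
        apply hm'
        exact tr.onPath_of_le hm (tr.anc_onPath _ _) (by omega)
      refine e.trans ?_
      apply tr.pathSum_le _ _ _ _ _ hxm0
      · intro m m' _ _ h; exact (hxmc m m' h).le
      · rw [tr.anc_stage l0 (tr.stage n) (tr.stage_pos n) (by rw [hl0]; exact tr.stage_le n)]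
  have hX0 : 0 ≤ X := Finset.sum_nonneg fun i _ => hxm0 i
  have hlow : ∀ n, tr.stage n < t → δ n ≤ ∑ m ∈ tr.pathSet n, xm m := by
    intro n hn
    refine (hx.2 n).trans (le_of_eq ?_)
    apply Finset.sum_congr rfl
    intro m hm
    have := tr.onPath_stage_le ((tr.mem_pathSet _ _).1 hm)
    simp only [hxm]; rw [if_pos (by omega)]
  have hlowX : ∀ n, tr.stage n < t → δ n ≤ X := by
    intro n hn
    refine (hlow n hn).trans ?_
    apply tr.pathSum_le _ _ _ _ (by rw [hl0]; exact tr.stage_le n) hxm0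
    intro m m' _ _ h; exact (hxmc m m' h).le
  have hdX : dm ≤ X := sup_le _ _ hX0 (fun n hn => hlowX n hn)
  set E := max (M - X) 0 with hE
  have hE0 : 0 ≤ E := le_max_right _ _
  have hEM : M ≤ X + E := by have := le_max_left (M - X) 0; linarith
  set z : Node → ℝ := fun n => if tr.stage n = t then E else 0 with hz
  have hz0 : ∀ n, 0 ≤ z n := by
    intro n; simp only [hz]; split_ifs; exacts [hE0, le_rfl]
  refine ⟨fun n => xm n + z n, ⟨⟨fun n => add_nonneg (hxm0 n) (hz0 n), ?_⟩, ?_⟩, ?_⟩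
  · intro n
    rw [Finset.sum_add_distrib]
    by_cases hn : tr.stage n < t
    · have := hlow n hn
      have hW : 0 ≤ ∑ k ∈ tr.pathSet n, z k := Finset.sum_nonneg fun i _ => hz0 i
      linarith
    · rw [hXall n (by omega)]
      have hW := tr.pathSum_root_le z hz0 (tr.anc_onPath n t)
      have hs := tr.anc_stage n t h1 (by omega)
      have hwv : z (tr.anc n t) = E := by simp [hz, hs]
      have := hMle n
      linarith
  · intro m n h
    simp only [hxmc m n h, hz, h]
  · -- cost comparison, scenario by scenario
    have hdp : tr.deltaPlus δ t = ∑ l ∈ tr.stageSet T, tr.prob l * D (tr.anc l t) := by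
      have e : tr.deltaPlus δ t
          = ∑ n, tr.prob n * (if tr.stage n = t then D n else 0) := by
        rw [deltaPlus, stageSet, Finset.sum_filter]
        apply Finset.sum_congr rfl
        intro n _
        split_ifs <;> simp [hD]
      rw [e, sum_eq_leaf]
      apply Finset.sum_congr rfl
      intro l hl
      rw [mem_stageSet] at hl
      have hs := tr.anc_stage l t h1 (by omega)
      congr 1
      rw [Finset.sum_eq_single (tr.anc l t)]
      · rw [if_pos hs]
      · intro b hb hne
        rw [mem_pathSet] at hb
        rw [if_neg]
        intro h
        exact hne (tr.onPath_unique hb (tr.anc_onPath l t) (by omega))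
      · intro h
        exact absurd ((tr.mem_pathSet _ _).2 (tr.anc_onPath l t)) h
    have key : ∀ l ∈ tr.stageSet T,
        tr.prob l * ∑ m ∈ tr.pathSet l, a m * (xm m + z m)
        ≤ tr.prob l * (∑ m ∈ tr.pathSet l, a m * x m
          + (A * M - (cm - cp) * dm - cp * D (tr.anc l t))) := by
      intro l hl
      rw [mem_stageSet] at hl
      apply mul_le_mul_of_nonneg_left _ (tr.prob_pos l).le
      have hs := tr.anc_stage l t h1 (by omega)
      set j := tr.anc l t with hj
      have hjl : tr.onPath j l := tr.anc_onPath l t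
      have s1 : ∑ m ∈ tr.pathSet l, a m * z m ≤ A * E := by
        rw [Finset.sum_eq_single j]
        · simp only [hz, hs, if_true]
          exact mul_le_mul_of_nonneg_right (hAle _) hE0
        · intro b hb hne
          rw [mem_pathSet] at hb
          simp only [hz]
          rw [if_neg, mul_zero]
          intro h
          exact hne (tr.onPath_unique hb hjl (by omega))
        · intro h
          exact absurd ((tr.mem_pathSet _ _).2 hjl) h
      have s2 : cp * ∑ m ∈ tr.pathSet l, xp m ≤ ∑ m ∈ tr.pathSet l, a m * xp m := by
        rw [Finset.mul_sum]
        apply Finset.sum_le_sum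
        intro m _
        by_cases hm : tr.stage m < t
        · simp [hxp, hm]
        · apply mul_le_mul_of_nonneg_right _ (hxp0 m)
          exact inf_le a {n | t ≤ tr.stage n} (not_lt.1 hm)
      have s3 : D j ≤ X + ∑ m ∈ tr.pathSet l, xp m := by
        have hp : 0 ≤ ∑ m ∈ tr.pathSet l, xp m := Finset.sum_nonneg fun i _ => hxp0 i
        apply sup_le _ _ (by linarith)
        rintro n (hn | hn)
        · have := hlowX n hn
          linarith
        · rw [← hXall l (by omega), ← Finset.sum_add_distrib,
            ← Finset.sum_congr rfl (fun n _ => hxs n)]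
          refine (hx.2 n).trans ?_
          apply tr.pathSum_le _ _ _ _ (by rw [hl]; exact tr.stage_le n) hx.1
          intro m m' hm hm' hmm
          apply le_of_eq
          by_cases hlt : tr.stage m < t
          · exact hc.1 m m' hmm hlt
          · exact hc.2 j hs m m' (tr.onPath_of_le hn hm (by omega))
              (tr.onPath_of_le hjl hm' (by omega)) hmm
      have s4 : 0 ≤ ∑ m ∈ tr.pathSet l, xp m := Finset.sum_nonneg fun i _ => hxp0 i
      have e1 : ∑ m ∈ tr.pathSet l, a m * (xm m + z m)
          = ∑ m ∈ tr.pathSet l, a m * xm m + ∑ m ∈ tr.pathSet l, a m * z m := by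
        rw [← Finset.sum_add_distrib]
        exact Finset.sum_congr rfl (fun _ _ => mul_add _ _ _)
      have e2 : ∑ m ∈ tr.pathSet l, a m * x m
          = ∑ m ∈ tr.pathSet l, a m * xm m + ∑ m ∈ tr.pathSet l, a m * xp m := by
        rw [← Finset.sum_add_distrib]
        refine Finset.sum_congr rfl (fun m _ => ?_)
        rw [hxs m, mul_add]
      rw [e1, e2]
      set S := ∑ m ∈ tr.pathSet l, xp m with hS
      have fin : A * E - cp * S ≤ A * M - (cm - cp) * dm - cp * D j := by
        have q1 : cm * dm ≤ A * dm := mul_le_mul_of_nonneg_right hcmA hm0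
        rcases le_total M X with hMX | hMX
        · have : E = 0 := max_eq_right (by linarith)
          rw [this]
          have q2 : 0 ≤ cp * S := mul_nonneg hcp0 s4
          have q3 : cp * (D j - dm) ≤ A * (D j - dm) :=
            mul_le_mul_of_nonneg_right hcpA (by linarith [hDm j])
          have q4 : A * D j ≤ A * M := mul_le_mul_of_nonneg_left (hDM j) hA0
          linarith
        · have : E = M - X := max_eq_left (by linarith)
          rw [this]
          have q2 : cp * (D j - X) ≤ cp * S := mul_le_mul_of_nonneg_left (by linarith) hcp0
          have q3 : cp * (X - dm) ≤ A * (X - dm) :=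
            mul_le_mul_of_nonneg_right hcpA (by linarith)
          linarith
      linarith
    have hsum := Finset.sum_le_sum key
    rw [lpObj_eq, lpObj_eq, hdp]
    refine hsum.trans (le_of_eq ?_)
    simp only [mul_add, mul_sub, Finset.sum_add_distrib, Finset.sum_sub_distrib]
    rw [← Finset.sum_mul, ← Finset.sum_mul, leaf_sum, one_mul, one_mul, Finset.mul_sum]
    congr 2
    apply Finset.sum_congr rfl
    intro l _
    ring

end ScenarioTree

/-- **Theorem 2 (VATS bounds vs. two-stage)**: bounds on the difference between the
two-stage LP value `v^T` and the adaptive two-stage LP value `v^R(t*)` for the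
single-resource capacity expansion problem. -/
theorem vT_sub_vR_bounds
    {T : ℕ} {Node : Type} [Fintype Node] [DecidableEq Node]
    (tr : ScenarioTree T Node)
    (a δ : Node → ℝ) (ha : ∀ n, 0 ≤ a n) (hδ : ∀ n, 0 ≤ δ n)
    (tstar : ℕ) (h1 : 1 ≤ tstar) (h2 : tstar ≤ T) :
    tr.aMin a * tr.deltaMax δ
        - (tr.aMinusHi a tstar - tr.aPlusHi a tstar) * tr.deltaMinus δ tstar
        - tr.aPlusHi a tstar * tr.deltaPlus δ tstar
      ≤ tr.vT a δ - tr.vR a δ tstar ∧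
    tr.vT a δ - tr.vR a δ tstar
      ≤ tr.aMax a * tr.deltaMax δ
        - (tr.aMinusLo a tstar - tr.aPlusLo a tstar) * tr.deltaMinus δ tstar
        - tr.aPlusLo a tstar * tr.deltaPlus δ tstar := by
  have bT : BddBelow (tr.lpObj a '' {x | tr.lpFeas δ x ∧ tr.twoStageConstr x}) :=
    ⟨0, by rintro _ ⟨x, hx, rfl⟩; exact tr.lpObj_nonneg a x ha hx.1.1⟩
  have bR : BddBelow (tr.lpObj a '' {x | tr.lpFeas δ x ∧ tr.adaptiveConstr tstar x}) :=
    ⟨0, by rintro _ ⟨x, hx, rfl⟩; exact tr.lpObj_nonneg a x ha hx.1.1⟩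
  obtain ⟨x0, hx0, hobj⟩ := tr.adaptive_upper a δ ha hδ tstar h1 h2
  constructor
  · have hR : tr.vR a δ tstar ≤ tr.lpObj a x0 := csInf_le bR ⟨x0, hx0, rfl⟩
    have hT : tr.aMin a * tr.deltaMax δ ≤ tr.vT a δ := by
      obtain ⟨y, hy⟩ := tr.exists_twoStage δ hδ
      refine le_csInf (Set.Nonempty.image _ ⟨y, hy⟩) ?_
      rintro _ ⟨x, hx, rfl⟩
      exact tr.twoStage_lower a δ x ha hx.1 hx.2
    linarith
  · have : tr.vT a δ - (tr.aMax a * tr.deltaMax δ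
        - (tr.aMinusLo a tstar - tr.aPlusLo a tstar) * tr.deltaMinus δ tstar
        - tr.aPlusLo a tstar * tr.deltaPlus δ tstar) ≤ tr.vR a δ tstar := by
      refine le_csInf (Set.Nonempty.image _ ⟨x0, hx0⟩) ?_
      rintro _ ⟨x, hx, rfl⟩
      obtain ⟨y, hy, hyo⟩ := tr.adaptive_to_twoStage a δ x ha hδ tstar h1 h2 hx.1 hx.2
      have : tr.vT a δ ≤ tr.lpObj a y := csInf_le bT ⟨y, hy, rfl⟩
      linarith
    linarith

end
end

section
/- Let 𝒯 be a scenario tree with T stages and nonnegative demands δ_n, let δ* = max_{n∈𝒯} δ_n, let t̂^D = min{ t ∈ {1,…,T} : δ_n = δ* for some n ∈ S_t } be the first stage at which the maximum demand occurs, and define δ^+(t) = Σ_{n∈S_t} p_n · max_{m∈𝒯(1,t−1)∪𝒯(n)} δ_m and t^{DB} := argmin_{2 ≤ t ≤ T} δ^+(t). Then: δ^+(t) ≤ δ* for every t; δ^+(1) = δ*; δ^+(t) = δ* for every t > t̂^D; consequently, if t̂^D = 1 then δ^+(t) = δ* for all t and t^{DB} may be any element of {2,…,T}, and otherwise the minimum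 of δ^+ over {2,…,T} is attained at some t^{DB} ∈ {2,…,t̂^D}. -/
open scoped Classical

noncomputable section

/-- `t̂^D`: the first stage at which the maximum demand `δ*` over the scenario tree occurs. -/
def ScenarioTree.tHatD {T : ℕ} {Node : Type} [Fintype Node] [DecidableEq Node]
    (tr : ScenarioTree T Node) (δ : Node → ℝ) : ℕ :=
  sInf {t | ∃ n, tr.stage n = t ∧ δ n = tr.deltaMax δ}

/-- **Proposition 6 (demand sensitivity)**: `δ^+(t) ≤ δ*` for every stage `t`,
`δ^+(1) = δ*`, and `δ^+(t) = δ*` for every stage `t > t̂^D`.  Consequently, if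
`t̂^D = 1` then `δ^+(t) = δ*` for every `t ∈ {2,…,T}` (so any revision time minimizes
the bound), and otherwise the minimum of `δ^+` over `{2,…,T}` is attained at some
`t^{DB} ∈ {2,…,t̂^D}`. -/
theorem demand_sensitivity_generic
    {T : ℕ} {Node : Type} [Fintype Node] [DecidableEq Node]
    (tr : ScenarioTree T Node)
    (δ : Node → ℝ) (hδ : ∀ n, 0 ≤ δ n) :
    (∀ t, 1 ≤ t → t ≤ T → tr.deltaPlus δ t ≤ tr.deltaMax δ) ∧
    tr.deltaPlus δ 1 = tr.deltaMax δ ∧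
    (∀ t, tr.tHatD δ < t → t ≤ T → tr.deltaPlus δ t = tr.deltaMax δ) ∧
    (tr.tHatD δ = 1 → ∀ t, 2 ≤ t → t ≤ T → tr.deltaPlus δ t = tr.deltaMax δ) ∧
    (tr.tHatD δ ≠ 1 → ∃ tDB, 2 ≤ tDB ∧ tDB ≤ tr.tHatD δ ∧
      ∀ t, 2 ≤ t → t ≤ T → tr.deltaPlus δ tDB ≤ tr.deltaPlus δ t) := by
  have hbdd : BddAbove (Set.range δ) := (Set.finite_range δ).bddAbove
  have hle : ∀ n, δ n ≤ tr.deltaMax δ := fun n => le_csSup hbdd ⟨n, rfl⟩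
  have hbdd2 : ∀ s : Set Node, BddAbove (δ '' s) := fun s => (Set.toFinite _).bddAbove
  have h0 : 0 ≤ tr.deltaMax δ := (hδ tr.root).trans (hle tr.root)
  have hsup : ∀ s : Set Node, sSup (δ '' s) ≤ tr.deltaMax δ := by
    intro s
    apply Real.sSup_le _ h0
    rintro _ ⟨n, _, rfl⟩
    exact hle n
  have hT : 1 ≤ T := tr.stage_root ▸ tr.stage_le tr.root
  have hsum : ∀ t, 1 ≤ t → t ≤ T →
      ∑ n ∈ tr.stageSet t, tr.prob n * tr.deltaMax δ = tr.deltaMax δ := by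
    intro t h1 h2
    have h := tr.prob_sum_stage t h1 h2
    rw [← Finset.sum_mul]
    have h' : ∑ n ∈ tr.stageSet t, tr.prob n = 1 := by
      rw [← h]
      unfold ScenarioTree.stageSet
      congr
    rw [h', one_mul]
  have hub : ∀ t, 1 ≤ t → t ≤ T → tr.deltaPlus δ t ≤ tr.deltaMax δ := by
    intro t h1 h2
    rw [← hsum t h1 h2]
    exact Finset.sum_le_sum fun n _ => mul_le_mul_of_nonneg_left (hsup _) (tr.prob_pos n).le
  have heq : ∀ t, 1 ≤ t → t ≤ T →
      (∀ n, tr.stage n = t → ∃ m, (tr.stage m < t ∨ tr.onPath n m) ∧ δ m = tr.deltaMax δ) →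
      tr.deltaPlus δ t = tr.deltaMax δ := by
    intro t h1 h2 h
    rw [← hsum t h1 h2]
    refine Finset.sum_congr rfl fun n hn => ?_
    obtain ⟨m, hm, hmd⟩ := h n (by simpa [ScenarioTree.stageSet] using hn)
    congr 1
    exact le_antisymm (hsup _) (hmd ▸ le_csSup (hbdd2 _) ⟨m, hm, rfl⟩)
  obtain ⟨m, hm⟩ : ∃ m, δ m = tr.deltaMax δ :=
    (Set.range_nonempty_iff_nonempty.2 ⟨tr.root⟩ : (Set.range δ).Nonempty).csSup_mem
      (Set.finite_range δ)
  obtain ⟨m', hm's, hm'⟩ : ∃ n, tr.stage n = tr.tHatD δ ∧ δ n = tr.deltaMax δ :=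
    Nat.sInf_mem (s := {t | ∃ n, tr.stage n = t ∧ δ n = tr.deltaMax δ}) ⟨_, m, rfl, hm⟩
  have hgt : ∀ t, tr.tHatD δ < t → t ≤ T → tr.deltaPlus δ t = tr.deltaMax δ := by
    intro t h1 h2
    exact heq t (by omega) h2 fun n _ => ⟨m', Or.inl (by omega), hm'⟩
  have hpos := tr.stage_pos m'
  have hmT := tr.stage_le m'
  refine ⟨hub, ?_, hgt, fun h t h1 h2 => hgt t (by omega) h2, fun h => ?_⟩
  · refine heq 1 le_rfl hT fun n hn => ⟨m, Or.inr ?_, hm⟩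
    rw [tr.root_unique n hn]
    exact tr.reaches_root m
  · obtain ⟨s, hs, hmin⟩ := Finset.exists_min_image (Finset.Icc 2 (tr.tHatD δ))
      (tr.deltaPlus δ) ⟨2, Finset.mem_Icc.2 ⟨le_rfl, by omega⟩⟩
    obtain ⟨hs1, hs2⟩ := Finset.mem_Icc.1 hs
    refine ⟨s, hs1, hs2, fun t h1 h2 => ?_⟩
    by_cases ht : t ≤ tr.tHatD δ
    · exact hmin t (Finset.mem_Icc.2 ⟨h1, ht⟩)
    · rw [hgt t (by omega) h2]
      exact hub s (by omega) (by omega)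

end
end

section
/- Let 𝒯 be a scenario tree with T stages whose demands are stagewise-independent in the following sense: for every stage t ∈ {2,…,T} there is a finite set D_t of N_t distinct demand values such that every node in S_{t−1} has exactly N_t children whose demand values are exactly the elements of D_t (one child per value). Let δ* = max_{n∈𝒯} δ_n, let t̂^D = min{ t : δ_n = δ* for some n ∈ S_t } ≥ 2, assume δ* belongs to D_{t̂^D} only (i.e., δ* ∉ D_s for every s ≠ t̂^D and the root demand is less than δ*), and assume N_{t̂^D} ≥ 2. Define δ^+(t) = Σ_{n∈S_t} p_n · max_{m∈𝒯(1,t−1)∪𝒯(n)} δ_m. Then δ^+(t) = δ* for every t ∈ {2,…,T} with t ≠ t̂^D, and δ^+(t̂^D) < δ*; hence the unique minimizer of δ^+ over {2,…,T} is t^{DB} = t̂^D. -/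
open scoped Classical

noncomputable section

theorem ScenarioTree.stage_iter_le {T : ℕ} {Node : Type} [Fintype Node] [DecidableEq Node]
    (tr : ScenarioTree T Node) (k : ℕ) (n : Node) :
    tr.stage (tr.parent^[k] n) ≤ tr.stage n := by
  induction k generalizing n with
  | zero => simp
  | succ k ih =>
    rw [Function.iterate_succ_apply]
    refine (ih _).trans ?_
    by_cases h : n = tr.root
    · rw [h, tr.parent_root]
    · have := tr.parent_stage n h
      omega

theorem ScenarioTree.exists_desc {T : ℕ} {Node : Type} [Fintype Node] [DecidableEq Node]
    (tr : ScenarioTree T Node) (n : Node) (k : ℕ) (hk : tr.stage n + k ≤ T) :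
    ∃ m, tr.onPath n m ∧ tr.stage m = tr.stage n + k := by
  induction k with
  | zero => exact ⟨n, ⟨0, rfl⟩, rfl⟩
  | succ k ih =>
    obtain ⟨m, ⟨j, hj⟩, hm⟩ := ih (by omega)
    have h1 := tr.prob_children m (by omega)
    have h2 := tr.prob_pos m
    rw [h1] at h2
    obtain ⟨c, hc, -⟩ := Finset.exists_ne_zero_of_sum_ne_zero h2.ne'
    simp only [Finset.mem_filter, Finset.mem_univ, true_and] at hc
    refine ⟨c, ⟨j + 1, ?_⟩, ?_⟩
    · rw [Function.iterate_succ_apply, hc.2, hj]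
    · have := tr.parent_stage c hc.1
      rw [hc.2] at this
      omega

/-- **Proposition 7 (demand sensitivity, stagewise-independent demands)**.
Suppose that for every stage `t ∈ {2,…,T}` there is a set `D_t` of `N_t` distinct
demand realizations such that the demand values of the children of every stage-`(t−1)`
node are exactly the elements of `D_t` (one child per value).  If the maximum demand
`δ*` first occurs at stage `t̂^D ≥ 2`, occurs only in `D_{t̂^D}` (not in `D_s` for
`s ≠ t̂^D` nor at the root), and `N_{t̂^D} ≥ 2`, then `δ^+(t) = δ*` for every
`t ∈ {2,…,T}` with `t ≠ t̂^D` while `δ^+(t̂^D) < δ*`; hence `t^{DB} = t̂^D` is the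
unique minimizer of `δ^+` over `{2,…,T}`. -/
theorem demand_sensitivity_stagewise_independent
    {T : ℕ} {Node : Type} [Fintype Node] [DecidableEq Node]
    (tr : ScenarioTree T Node)
    (δ : Node → ℝ) (hδ : ∀ n, 0 ≤ δ n)
    (Dt : ℕ → Finset ℝ) (Nt : ℕ → ℕ)
    (hcard : ∀ t, 2 ≤ t → t ≤ T → (Dt t).card = Nt t)
    (hindep : ∀ t, 2 ≤ t → t ≤ T → ∀ n, tr.stage n = t - 1 →
      Set.BijOn δ {m | m ≠ tr.root ∧ tr.parent m = n} ↑(Dt t))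
    (htHat2 : 2 ≤ tr.tHatD δ)
    (honly : ∀ s, 2 ≤ s → s ≤ T → s ≠ tr.tHatD δ → tr.deltaMax δ ∉ Dt s)
    (hroot : δ tr.root < tr.deltaMax δ)
    (hN2 : 2 ≤ Nt (tr.tHatD δ)) :
    (∀ t, 2 ≤ t → t ≤ T → t ≠ tr.tHatD δ → tr.deltaPlus δ t = tr.deltaMax δ) ∧
    tr.deltaPlus δ (tr.tHatD δ) < tr.deltaMax δ ∧
    (∀ t, 2 ≤ t → t ≤ T → t ≠ tr.tHatD δ →
      tr.deltaPlus δ (tr.tHatD δ) < tr.deltaPlus δ t) := by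
  set M := tr.deltaMax δ with hM
  set h := tr.tHatD δ with hh
  have hle : ∀ n, δ n ≤ M := fun n =>
    le_csSup (Set.finite_range δ).bddAbove ⟨n, rfl⟩
  have hne : {t | ∃ n, tr.stage n = t ∧ δ n = tr.deltaMax δ}.Nonempty := by
    have : sSup (Set.range δ) ∈ Set.range δ :=
      Set.Nonempty.csSup_mem ⟨_, tr.root, rfl⟩ (Set.finite_range δ)
    obtain ⟨n, hn⟩ := this
    exact ⟨_, n, rfl, hn⟩
  obtain ⟨n0, hn0s, hn0⟩ : ∃ n, tr.stage n = h ∧ δ n = M := Nat.sInf_mem hne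
  have hT : h ≤ T := hn0s ▸ tr.stage_le n0
  have hmemD : ∀ n, n ≠ tr.root → δ n ∈ Dt (tr.stage n) := by
    intro n hn
    have h1 := tr.parent_stage n hn
    have h2 := tr.stage_pos (tr.parent n)
    exact (hindep (tr.stage n) (by omega) (tr.stage_le n) (tr.parent n) (by omega)).mapsTo
      ⟨hn, rfl⟩
  have hstage : ∀ n, δ n = M → tr.stage n = h := by
    intro n hn
    have hr : n ≠ tr.root := by
      rintro rfl
      exact absurd hn hroot.ne
    by_contra hc
    have h1 := tr.parent_stage n hr
    have h2 := tr.stage_pos (tr.parent n)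
    have h3 := hmemD n hr
    rw [hn] at h3
    exact honly _ (by omega) (tr.stage_le n) hc h3
  have hn0r : n0 ≠ tr.root := by
    rintro rfl
    exact absurd hn0 hroot.ne
  have hMD : M ∈ Dt h := by
    have := hmemD n0 hn0r
    rwa [hn0, hn0s] at this
  have hsup_le : ∀ t n, sSup (δ '' {m | tr.stage m < t ∨ tr.onPath n m}) ≤ M := by
    intro t n
    apply csSup_le
    · exact ⟨_, n, Or.inr ⟨0, rfl⟩, rfl⟩
    · rintro _ ⟨m, -, rfl⟩
      exact hle m
  have hsum : ∀ t, 2 ≤ t → t ≤ T → ∑ n ∈ tr.stageSet t, tr.prob n * M = M := by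
    intro t h2 ht
    have := tr.prob_sum_stage t (by omega) ht
    rw [← Finset.sum_mul]
    unfold ScenarioTree.stageSet
    rw [this, one_mul]
  have A : ∀ t, 2 ≤ t → t ≤ T → t ≠ h → tr.deltaPlus δ t = M := by
    intro t h2 ht hth
    rw [← hsum t h2 ht]
    unfold ScenarioTree.deltaPlus
    refine Finset.sum_congr rfl fun n hn => ?_
    have hns : tr.stage n = t := by simpa [ScenarioTree.stageSet] using hn
    congr 1
    refine le_antisymm (hsup_le t n) ?_
    obtain ⟨m, hm, hmM⟩ : ∃ m, (tr.stage m < t ∨ tr.onPath n m) ∧ δ m = M := by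
      rcases lt_or_gt_of_ne hth with hlt | hgt
      · obtain ⟨m, ⟨j, hj⟩, hm⟩ := tr.exists_desc n (h - 1 - t) (by omega)
        obtain ⟨c, ⟨-, hc⟩, hcM⟩ := (hindep h htHat2 hT m (by omega)).surjOn hMD
        exact ⟨c, Or.inr ⟨j + 1, by rw [Function.iterate_succ_apply, hc, hj]⟩, hcM⟩
      · exact ⟨n0, Or.inl (by omega), hn0⟩
    rw [← hmM]
    exact le_csSup (Set.toFinite _).bddAbove ⟨m, hm, rfl⟩
  have B : tr.deltaPlus δ h < M := by
    conv_rhs => rw [← hsum h htHat2 hT]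
    unfold ScenarioTree.deltaPlus
    obtain ⟨d, hd, hdM⟩ := Finset.exists_mem_ne
      (show 1 < (Dt h).card by rw [hcard h htHat2 hT]; omega) M
    have h1 := tr.parent_stage n0 hn0r
    obtain ⟨c, ⟨hcr, hcp⟩, hcd⟩ :=
      (hindep h htHat2 hT (tr.parent n0) (by omega)).surjOn hd
    have h2 := tr.parent_stage c hcr
    rw [hcp] at h2
    have hcs : tr.stage c = h := by omega
    refine Finset.sum_lt_sum
      (fun n _ => mul_le_mul_of_nonneg_left (hsup_le h n) (tr.prob_pos n).le)
      ⟨c, by simp [ScenarioTree.stageSet, hcs], ?_⟩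
    refine mul_lt_mul_of_pos_left ?_ (tr.prob_pos c)
    refine lt_of_le_of_ne (hsup_le h c) fun heq => ?_
    obtain ⟨m, hm, hmM⟩ : sSup (δ '' {m | tr.stage m < h ∨ tr.onPath c m}) ∈
        δ '' {m | tr.stage m < h ∨ tr.onPath c m} :=
      Set.Nonempty.csSup_mem ⟨_, c, Or.inr ⟨0, rfl⟩, rfl⟩ (Set.toFinite _)
    rw [heq] at hmM
    have hms := hstage m hmM
    rcases hm with hm | ⟨k, hk⟩
    · omega
    · cases k with
      | zero =>
        simp only [Function.iterate_zero, id_eq] at hk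
        rw [hk, hcd] at hmM
        exact hdM hmM
      | succ k =>
        rw [Function.iterate_succ_apply] at hk
        have h3 := tr.stage_iter_le k (tr.parent m)
        rw [hk] at h3
        have hmr : m ≠ tr.root := by
          rintro rfl
          exact absurd hmM hroot.ne
        have h4 := tr.parent_stage m hmr
        omega
  exact ⟨A, B, fun t h2 ht hth => by rw [A t h2 ht hth]; exact B⟩

end
end

section
/- For the stochastic capacity expansion planning problem on a scenario tree 𝒯 with resources i = 1,…,I, let {y_n^{TLP}}_{n∈𝒯} be the optimal capacity allocation decisions of the linear programming relaxation of the two-stage version of the problem, and set δ_{in} = [A_n y_n^{TLP}]_i for each resource i and node n. Then for any vector of revision times t* = (t_1*,…,t_I*), V^{TS} − V^{ATS}(t*) ≥ Σ_{i=1}^I ( v_i^T − v_i^R(t_i*) − max_{n ∈ 𝒯_i(t_i*)} { ⌈δ_{in}⌉ − δ_{in} } · a_{i1} ), where v_i^T and v_i^R(t_i*) are the optimal values of the LP relaxations of the single-resource two-stage and adaptive two-stage problems, respectively, with right-hand-side demands δ_{in}, and a_{i1} is the first-stage unit acquisition cost of resource i. -/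
open scoped Classical

noncomputable section

section CapacityExpansion

variable {T : ℕ} {Node : Type} [Fintype Node] [DecidableEq Node]
variable {I J K : ℕ}

/-- Objective `∑_{n∈𝒯} p_n (a_n^⊤ x_n + b_n^⊤ y_n)` of the stochastic capacity
expansion planning problem (`x`: capacity acquisitions, `y`: capacity allocations). -/
def capObj (tr : ScenarioTree T Node) (a : Node → Fin I → ℝ) (b : Node → Fin J → ℝ)
    (x : Node → Fin I → ℝ) (y : Node → Fin J → ℝ) : ℝ :=
  ∑ n, tr.prob n * ((∑ i, a n i * x n i) + (∑ j, b n j * y n j))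

/-- Constraints of the stochastic capacity expansion planning problem (with the
integrality of `x` relaxed): `x ≥ 0`, `y ≥ 0`, `A_n y_n ≤ ∑_{m∈P(n)} x_m`, and
`B_n y_n ≥ d_n` for all nodes `n`. -/
def capFeas (tr : ScenarioTree T Node)
    (A : Node → Matrix (Fin I) (Fin J) ℝ) (B : Node → Matrix (Fin K) (Fin J) ℝ)
    (dem : Node → Fin K → ℝ)
    (x : Node → Fin I → ℝ) (y : Node → Fin J → ℝ) : Prop :=
  (∀ n i, 0 ≤ x n i) ∧ (∀ n j, 0 ≤ y n j) ∧
  (∀ n (i : Fin I), (A n).mulVec (y n) i ≤ ∑ m ∈ tr.pathSet n, x m i) ∧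
  (∀ n (k : Fin K), dem n k ≤ (B n).mulVec (y n) k)

/-- Integrality of the capacity acquisition decisions: `x_n ∈ ℤ_+^I`. -/
def capIntegral {Node : Type} (x : Node → Fin I → ℝ) : Prop :=
  ∀ n i, ∃ z : ℕ, x n i = (z : ℝ)

/-- `V^{TS}`: optimal value of the two-stage stochastic capacity expansion problem. -/
def VTS (tr : ScenarioTree T Node) (a : Node → Fin I → ℝ) (b : Node → Fin J → ℝ)
    (A : Node → Matrix (Fin I) (Fin J) ℝ) (B : Node → Matrix (Fin K) (Fin J) ℝ)
    (dem : Node → Fin K → ℝ) : ℝ :=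
  sInf {v : ℝ | ∃ x y, capFeas tr A B dem x y ∧ capIntegral x ∧
    (∀ i : Fin I, tr.twoStageConstr (fun n => x n i)) ∧ v = capObj tr a b x y}

/-- `V^{MS}`: optimal value of the multi-stage stochastic capacity expansion problem. -/
def VMS (tr : ScenarioTree T Node) (a : Node → Fin I → ℝ) (b : Node → Fin J → ℝ)
    (A : Node → Matrix (Fin I) (Fin J) ℝ) (B : Node → Matrix (Fin K) (Fin J) ℝ)
    (dem : Node → Fin K → ℝ) : ℝ :=
  sInf {v : ℝ | ∃ x y, capFeas tr A B dem x y ∧ capIntegral x ∧ v = capObj tr a b x y}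

/-- `V^{ATS}(t*)`: optimal value of the adaptive two-stage stochastic capacity
expansion problem under the given vector `t*` of revision times. -/
def VATS (tr : ScenarioTree T Node) (a : Node → Fin I → ℝ) (b : Node → Fin J → ℝ)
    (A : Node → Matrix (Fin I) (Fin J) ℝ) (B : Node → Matrix (Fin K) (Fin J) ℝ)
    (dem : Node → Fin K → ℝ) (tstar : Fin I → ℕ) : ℝ :=
  sInf {v : ℝ | ∃ x y, capFeas tr A B dem x y ∧ capIntegral x ∧
    (∀ i : Fin I, tr.adaptiveConstr (tstar i) (fun n => x n i)) ∧ v = capObj tr a b x y}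

/-- `V^{ATS}`: optimal value of the adaptive two-stage capacity expansion problem in
which the revision times themselves are optimized. -/
def VATSopt (tr : ScenarioTree T Node) (a : Node → Fin I → ℝ) (b : Node → Fin J → ℝ)
    (A : Node → Matrix (Fin I) (Fin J) ℝ) (B : Node → Matrix (Fin K) (Fin J) ℝ)
    (dem : Node → Fin K → ℝ) : ℝ :=
  sInf {v : ℝ | ∃ tstar : Fin I → ℕ, (∀ i, 1 ≤ tstar i ∧ tstar i ≤ T) ∧
    v = VATS tr a b A B dem tstar}

/-- The merged demand values `δ̂_n = max_{m ∈ Ĉ_n} δ_m` of the condensed scenario tree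
`𝒯_i(t*)`: one value for each stage `t < t*` (all stage-`t` nodes are merged) and one
value for each pair of a node `j ∈ S_{t*}` and a stage `t ≥ t*` (the nodes of
`S_t ∩ 𝒯(j)` are merged). -/
def ScenarioTree.condensedDemands (tr : ScenarioTree T Node) (δ : Node → ℝ)
    (tstar : ℕ) : Set ℝ :=
  {v | ∃ t, 1 ≤ t ∧ t < tstar ∧ v = sSup (δ '' {m | tr.stage m = t})} ∪
  {v | ∃ j, tr.stage j = tstar ∧ ∃ t, tstar ≤ t ∧ t ≤ T ∧
    v = sSup (δ '' {m | tr.stage m = t ∧ tr.onPath j m})}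

/-- `max_{n ∈ 𝒯_i(t*)} (⌈δ_{in}⌉ − δ_{in})`: the maximum integrality (ceiling) gap of
the merged demands over the condensed scenario tree. -/
def ScenarioTree.condGap (tr : ScenarioTree T Node) (δ : Node → ℝ) (tstar : ℕ) : ℝ :=
  sSup ((fun v => (⌈v⌉ : ℝ) - v) '' tr.condensedDemands δ tstar)

end CapacityExpansion

namespace ScenarioTree

variable {T : ℕ} {Node : Type} [Fintype Node] [DecidableEq Node]

theorem aux_onPath_stage (tr : ScenarioTree T Node) (j n : Node) (h : tr.onPath j n) :
    tr.stage j ≤ tr.stage n := by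
  obtain ⟨k, rfl⟩ := h
  induction k generalizing n with
  | zero => simp
  | succ k ih =>
    rw [Function.iterate_succ_apply]
    refine (ih _).trans ?_
    by_cases hn : n = tr.root
    · subst hn; rw [tr.parent_root]
    · have := tr.parent_stage n hn; omega

theorem aux_onPath_cases (tr : ScenarioTree T Node) (j n : Node) (h : tr.onPath j n) :
    j = n ∨ tr.onPath j (tr.parent n) := by
  obtain ⟨k, hk⟩ := h
  cases k with
  | zero => left; simpa using hk.symm
  | succ k => right; exact ⟨k, by rwa [Function.iterate_succ_apply] at hk⟩

theorem aux_onPath_parent (tr : ScenarioTree T Node) (j n : Node)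
    (h : tr.onPath j (tr.parent n)) : tr.onPath j n := by
  obtain ⟨k, hk⟩ := h
  exact ⟨k + 1, by rwa [Function.iterate_succ_apply]⟩

theorem aux_pathSet_root (tr : ScenarioTree T Node) : tr.pathSet tr.root = {tr.root} := by
  ext m
  simp only [pathSet, Finset.mem_filter, Finset.mem_univ, true_and, Finset.mem_singleton]
  constructor
  · rintro ⟨k, hk⟩
    rw [← hk]
    exact Function.iterate_fixed tr.parent_root k
  · rintro rfl
    exact ⟨0, rfl⟩

theorem aux_sum_succ (tr : ScenarioTree T Node) (x : Node → ℝ) (n : Node) (hn : n ≠ tr.root) :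
    ∑ m ∈ tr.pathSet n, x m = x n + ∑ m ∈ tr.pathSet (tr.parent n), x m := by
  have h1 : tr.pathSet n = insert n (tr.pathSet (tr.parent n)) := by
    ext m
    simp only [pathSet, Finset.mem_filter, Finset.mem_univ, true_and, Finset.mem_insert]
    constructor
    · exact tr.aux_onPath_cases m n
    · rintro (rfl | h)
      · exact ⟨0, rfl⟩
      · exact tr.aux_onPath_parent _ _ h
  have h2 : n ∉ tr.pathSet (tr.parent n) := by
    simp only [pathSet, Finset.mem_filter, Finset.mem_univ, true_and]
    intro h
    have := tr.aux_onPath_stage _ _ h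
    have := tr.parent_stage n hn
    omega
  rw [h1, Finset.sum_insert h2]

theorem aux_induct (tr : ScenarioTree T Node) (P : Node → Prop) (h0 : P tr.root)
    (hs : ∀ n, n ≠ tr.root → P (tr.parent n) → P n) (n : Node) : P n := by
  obtain ⟨k, hk⟩ := tr.reaches_root n
  induction k generalizing n with
  | zero => simp at hk; rwa [hk]
  | succ k ih =>
    by_cases hn : n = tr.root
    · rwa [hn]
    · exact hs n hn (ih _ (by rwa [Function.iterate_succ_apply] at hk))

/-- increments of a cumulative function -/
def auxIncr (tr : ScenarioTree T Node) (F : Node → ℝ) (n : Node) : ℝ :=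
  if n = tr.root then F n else F n - F (tr.parent n)

theorem aux_sum_incr (tr : ScenarioTree T Node) (F : Node → ℝ) (n : Node) :
    ∑ m ∈ tr.pathSet n, tr.auxIncr F m = F n := by
  induction n using tr.aux_induct with
  | h0 => rw [aux_pathSet_root]; simp [auxIncr]
  | hs n hn ih => rw [aux_sum_succ _ _ _ hn, ih]; simp [auxIncr, hn]

theorem aux_anc (tr : ScenarioTree T Node) (t : ℕ) (ht : 1 ≤ t) (n : Node)
    (hn : t ≤ tr.stage n) : ∃ j, tr.stage j = t ∧ tr.onPath j n := by
  induction n using tr.aux_induct with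
  | h0 =>
    rw [tr.stage_root] at hn
    exact ⟨tr.root, by rw [tr.stage_root]; omega, 0, rfl⟩
  | hs n hr ih =>
    by_cases h : tr.stage n = t
    · exact ⟨n, h, 0, rfl⟩
    · have := tr.parent_stage n hr
      obtain ⟨j, hj, hp⟩ := ih (by omega)
      exact ⟨j, hj, tr.aux_onPath_parent _ _ hp⟩

/-- nodes forced equal -/
def auxRel (tr : ScenarioTree T Node) (t : ℕ) (m n : Node) : Prop :=
  m = n ∨ (tr.stage m = tr.stage n ∧
    (tr.stage m < t ∨ ∃ j, tr.stage j = t ∧ tr.onPath j m ∧ tr.onPath j n))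

theorem auxRel_stage {tr : ScenarioTree T Node} {t : ℕ} {m n : Node} (h : tr.auxRel t m n) :
    tr.stage m = tr.stage n := by
  rcases h with rfl | h
  · rfl
  · exact h.1

theorem auxRel_root {tr : ScenarioTree T Node} {t : ℕ} {m n : Node} (h : tr.auxRel t m n) :
    m = tr.root ↔ n = tr.root := by
  have := auxRel_stage h
  constructor
  · rintro rfl; exact tr.root_unique _ (by rw [← this, tr.stage_root])
  · rintro rfl; exact tr.root_unique _ (by rw [this, tr.stage_root])

theorem auxRel_parent {tr : ScenarioTree T Node} {t : ℕ} {m n : Node} (h : tr.auxRel t m n)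
    (hm : m ≠ tr.root) : m = n ∨ tr.auxRel t (tr.parent m) (tr.parent n) := by
  have hn : n ≠ tr.root := fun h' => hm ((auxRel_root h).2 h')
  have h1 := tr.parent_stage m hm
  have h2 := tr.parent_stage n hn
  rcases h with rfl | ⟨hs, h | ⟨j, hj, hjm, hjn⟩⟩
  · left; rfl
  · right; right; exact ⟨by omega, Or.inl (by omega)⟩
  · rcases tr.aux_onPath_cases _ _ hjm with rfl | hm'
    · rcases tr.aux_onPath_cases _ _ hjn with rfl | hn'
      · left; rfl
      · have := tr.aux_onPath_stage _ _ hn'; omega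
    · rcases tr.aux_onPath_cases _ _ hjn with rfl | hn'
      · have := tr.aux_onPath_stage _ _ hm'; omega
      · right; right; exact ⟨by omega, Or.inr ⟨j, hj, hm', hn'⟩⟩

theorem aux_adaptive_iff (tr : ScenarioTree T Node) (t : ℕ) (x : Node → ℝ) :
    tr.adaptiveConstr t x ↔ ∀ m n, tr.auxRel t m n → x m = x n := by
  constructor
  · rintro ⟨h1, h2⟩ m n (rfl | ⟨hs, h | ⟨j, hj, hjm, hjn⟩⟩)
    · rfl
    · exact h1 m n hs h
    · exact h2 j hj m n hjm hjn hs
  · intro h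
    exact ⟨fun m n hs hl => h m n (Or.inr ⟨hs, Or.inl hl⟩),
      fun j hj m n hm hn hs => h m n (Or.inr ⟨hs, Or.inr ⟨j, hj, hm, hn⟩⟩)⟩

theorem aux_cum_eq (tr : ScenarioTree T Node) (t : ℕ) (x : Node → ℝ)
    (hx : tr.adaptiveConstr t x) (m n : Node) (h : tr.auxRel t m n) :
    ∑ k ∈ tr.pathSet m, x k = ∑ k ∈ tr.pathSet n, x k := by
  rw [aux_adaptive_iff] at hx
  induction m using tr.aux_induct generalizing n with
  | h0 => rw [(auxRel_root h).1 rfl]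
  | hs m hm ih =>
    have hn : n ≠ tr.root := fun h' => hm ((auxRel_root h).2 h')
    rcases auxRel_parent h hm with rfl | h'
    · rfl
    · rw [aux_sum_succ _ _ _ hm, aux_sum_succ _ _ _ hn, hx m n h, ih _ h']

theorem aux_incr_adaptive (tr : ScenarioTree T Node) (t : ℕ) (F : Node → ℝ)
    (hF : ∀ m n, tr.auxRel t m n → F m = F n) : tr.adaptiveConstr t (tr.auxIncr F) := by
  rw [aux_adaptive_iff]
  intro m n h
  by_cases hm : m = tr.root
  · rw [hm, (auxRel_root h).1 hm]
  · have hn : n ≠ tr.root := fun h' => hm ((auxRel_root h).2 h')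
    rcases auxRel_parent h hm with rfl | h'
    · rfl
    · simp only [auxIncr, hm, hn, if_false, hF _ _ h, hF _ _ h']

theorem aux_prob_root (tr : ScenarioTree T Node) : tr.prob tr.root = 1 := by
  have hT : 1 ≤ T := tr.stage_root ▸ tr.stage_le tr.root
  rw [← tr.prob_sum_stage 1 le_rfl hT]
  have : Finset.univ.filter (fun n => tr.stage n = 1) = {tr.root} := by
    ext n
    simp only [Finset.mem_filter, Finset.mem_univ, true_and, Finset.mem_singleton]
    exact ⟨tr.root_unique n, fun h => h ▸ tr.stage_root⟩
  rw [this, Finset.sum_singleton]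

theorem aux_gap_nonneg (tr : ScenarioTree T Node) (δ : Node → ℝ) (t : ℕ) :
    0 ≤ tr.condGap δ t := by
  apply Real.sSup_nonneg
  rintro _ ⟨v, _, rfl⟩
  simpa using Int.le_ceil v

theorem aux_le_gap (tr : ScenarioTree T Node) (δ : Node → ℝ) (t : ℕ) (v : ℝ)
    (hv : v ∈ tr.condensedDemands δ t) : (⌈v⌉ : ℝ) - v ≤ tr.condGap δ t := by
  apply le_csSup
  · refine ⟨1, ?_⟩
    rintro _ ⟨v, _, rfl⟩
    have := Int.ceil_lt_add_one v
    simp only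
    linarith
  · exact ⟨v, hv, rfl⟩

/-- rounded demand is met after adding the gap at the root. -/
theorem aux_ceil_le (tr : ScenarioTree T Node) (δ x : Node → ℝ) (t : ℕ) (ht : 1 ≤ t)
    (hx : tr.lpFeas δ x) (hc : tr.adaptiveConstr t x) (n : Node) :
    ∃ z : ℤ, δ n ≤ z ∧ (z : ℝ) ≤ ∑ k ∈ tr.pathSet n, x k + tr.condGap δ t := by
  have key : ∀ s : Set Node, n ∈ s → (∀ m ∈ s, tr.auxRel t m n) →
      sSup (δ '' s) ∈ tr.condensedDemands δ t →
      ∃ z : ℤ, δ n ≤ z ∧ (z : ℝ) ≤ ∑ k ∈ tr.pathSet n, x k + tr.condGap δ t := by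
    intro s hn hs hv
    refine ⟨⌈sSup (δ '' s)⌉, ?_, ?_⟩
    · exact (le_csSup (Set.toFinite _).bddAbove (Set.mem_image_of_mem δ hn)).trans (Int.le_ceil _)
    · have h1 := tr.aux_le_gap δ t _ hv
      have h2 : sSup (δ '' s) ≤ ∑ k ∈ tr.pathSet n, x k := by
        apply csSup_le ((Set.nonempty_of_mem hn).image δ)
        rintro _ ⟨m, hm, rfl⟩
        rw [← tr.aux_cum_eq t x hc m n (hs m hm)]
        exact hx.2 m
      linarith
  by_cases h : tr.stage n < t
  · apply key {m | tr.stage m = tr.stage n} rfl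
    · intro m hm
      have hm' : tr.stage m = tr.stage n := hm
      exact Or.inr ⟨hm', Or.inl (by omega)⟩
    · left
      exact ⟨tr.stage n, tr.stage_pos n, h, rfl⟩
  · push Not at h
    obtain ⟨j, hj, hjn⟩ := tr.aux_anc t ht n h
    apply key {m | tr.stage m = tr.stage n ∧ tr.onPath j m} ⟨rfl, hjn⟩
    · rintro m ⟨hm, hjm⟩
      exact Or.inr ⟨hm, Or.inr ⟨j, hj, hjm, hjn⟩⟩
    · right
      exact ⟨j, hj, tr.stage n, h, tr.stage_le n, rfl⟩

theorem aux_floor_ae (c : ℝ) :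
    (fun θ : ℝ => ((⌊c + θ⌋ : ℤ) : ℝ)) =ᵐ[MeasureTheory.volume.restrict (Set.Ico (0:ℝ) 1)]
    fun θ => (⌊c⌋ : ℝ) + (Set.Ico (1 - Int.fract c) 1).indicator (fun _ => (1:ℝ)) θ := by
  filter_upwards [MeasureTheory.ae_restrict_mem measurableSet_Ico] with θ hθ
  have h1 := Int.floor_add_fract c
  have h2 := Int.fract_nonneg c
  have h3 := Int.fract_lt_one c
  by_cases h : 1 - Int.fract c ≤ θ
  · rw [Set.indicator_of_mem (show θ ∈ Set.Ico (1 - Int.fract c) 1 from ⟨h, hθ.2⟩)]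
    have : ⌊c + θ⌋ = ⌊c⌋ + 1 := by
      rw [Int.floor_eq_iff]; push_cast; constructor <;> linarith [hθ.1, hθ.2]
    rw [this]; push_cast; rfl
  · rw [Set.indicator_of_notMem (fun h' => h h'.1)]
    have : ⌊c + θ⌋ = ⌊c⌋ := by
      rw [Int.floor_eq_iff]; constructor <;> linarith [hθ.1, hθ.2]
    rw [this]; simp

theorem aux_floor_integrable (c : ℝ) :
    MeasureTheory.Integrable (fun θ : ℝ => ((⌊c + θ⌋ : ℤ) : ℝ))
      (MeasureTheory.volume.restrict (Set.Ico (0:ℝ) 1)) := by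
  rw [MeasureTheory.integrable_congr (aux_floor_ae c)]
  exact (MeasureTheory.integrable_const _).add
    ((MeasureTheory.integrable_const _).indicator measurableSet_Ico)

theorem aux_floor_integral (c : ℝ) :
    ∫ θ in Set.Ico (0:ℝ) 1, ((⌊c + θ⌋ : ℤ) : ℝ) = c := by
  have h1 := Int.floor_add_fract c
  have h2 := Int.fract_nonneg c
  have h3 := Int.fract_lt_one c
  rw [MeasureTheory.integral_congr_ae (aux_floor_ae c),
    MeasureTheory.integral_add (MeasureTheory.integrable_const _)
      ((MeasureTheory.integrable_const _).indicator measurableSet_Ico),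
    MeasureTheory.integral_indicator measurableSet_Ico,
    MeasureTheory.Measure.restrict_restrict measurableSet_Ico]
  have : Set.Ico (1 - Int.fract c) 1 ∩ Set.Ico 0 1 = Set.Ico (1 - Int.fract c) 1 := by
    rw [Set.inter_eq_left]
    exact Set.Ico_subset_Ico (by linarith) le_rfl
  rw [this]
  simp [h2]

/-- rounding lemma -/
theorem aux_round (tr : ScenarioTree T Node) (a δ x : Node → ℝ) (t : ℕ) (ht : 1 ≤ t)
    (hx : tr.lpFeas δ x) (hc : tr.adaptiveConstr t x) :
    ∃ x' : Node → ℝ, tr.lpFeas δ x' ∧ tr.adaptiveConstr t x' ∧ (∀ n, ∃ z : ℕ, x' n = z) ∧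
      tr.lpObj a x' ≤ tr.lpObj a x + tr.condGap δ t * a tr.root := by
  set g := tr.condGap δ t with hg
  have hg0 : 0 ≤ g := tr.aux_gap_nonneg δ t
  set X : Node → ℝ := fun n => ∑ k ∈ tr.pathSet n, x k + g with hX
  let F : ℝ → Node → ℝ := fun θ n => ((⌊X n + θ⌋ : ℤ) : ℝ)
  set μ := MeasureTheory.volume.restrict (Set.Ico (0:ℝ) 1) with hμ
  have hFi : ∀ n, MeasureTheory.Integrable (fun θ => F θ n) μ :=
    fun n => aux_floor_integrable (X n)
  have hFI : ∀ n, ∫ θ, F θ n ∂μ = X n := fun n => aux_floor_integral (X n)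
  have hii : ∀ n, MeasureTheory.Integrable (fun θ => tr.auxIncr (F θ) n) μ := by
    intro n
    by_cases hn : n = tr.root
    · simpa [auxIncr, hn] using hFi tr.root
    · simp only [auxIncr, hn, if_false]
      exact (hFi n).sub (hFi _)
  have hiI : ∀ n, ∫ θ, tr.auxIncr (F θ) n ∂μ = x n + if n = tr.root then g else 0 := by
    intro n
    by_cases hn : n = tr.root
    · simp only [auxIncr, hn, if_true]
      rw [hFI]
      simp [hX, aux_pathSet_root]
    · simp only [auxIncr, hn, if_false]
      rw [MeasureTheory.integral_sub (hFi n) (hFi _), hFI, hFI]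
      simp only [hX]
      rw [aux_sum_succ _ _ _ hn]; ring
  have hprob : MeasureTheory.IsProbabilityMeasure μ := ⟨by simp [hμ]⟩
  have hOi : MeasureTheory.Integrable (fun θ => tr.lpObj a (tr.auxIncr (F θ))) μ := by
    unfold lpObj
    exact MeasureTheory.integrable_finsetSum _ fun n _ => (hii n).const_mul _
  have hOI : ∫ θ, tr.lpObj a (tr.auxIncr (F θ)) ∂μ = tr.lpObj a x + g * a tr.root := by
    unfold lpObj
    rw [MeasureTheory.integral_finsetSum _ fun n _ => (hii n).const_mul _]
    simp_rw [MeasureTheory.integral_const_mul, hiI, mul_add]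
    rw [Finset.sum_add_distrib]
    simp [aux_prob_root, mul_comm]
  obtain ⟨θ, hθm, hθ⟩ : ∃ θ ∈ Set.Ici (0:ℝ), tr.lpObj a (tr.auxIncr (F θ)) ≤
      ∫ θ, tr.lpObj a (tr.auxIncr (F θ)) ∂μ := by
    have hN : μ (Set.Ici (0:ℝ))ᶜ = 0 := by
      rw [hμ, MeasureTheory.Measure.restrict_apply measurableSet_Ici.compl]
      have : (Set.Ici (0:ℝ))ᶜ ∩ Set.Ico 0 1 = ∅ := by
        ext y; simp only [Set.mem_inter_iff, Set.mem_compl_iff, Set.mem_Ici, Set.mem_Ico,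
          Set.mem_empty_iff_false, iff_false]; tauto
      rw [this]; simp
    obtain ⟨θ, h1, h2⟩ := MeasureTheory.exists_notMem_null_le_integral hOi hN
    exact ⟨θ, by simpa using h1, h2⟩
  have hθ0 : 0 ≤ θ := hθm
  have hnat : ∀ n, ∃ z : ℕ, tr.auxIncr (F θ) n = z := by
    intro n
    have : ∃ z : ℤ, 0 ≤ z ∧ tr.auxIncr (F θ) n = z := by
      by_cases hn : n = tr.root
      · refine ⟨⌊X n + θ⌋, ?_, by simp [auxIncr, hn, F]⟩
        apply Int.floor_nonneg.2
        have : 0 ≤ ∑ k ∈ tr.pathSet n, x k := Finset.sum_nonneg fun k _ => hx.1 k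
        simp only [hX]; linarith
      · refine ⟨⌊X n + θ⌋ - ⌊X (tr.parent n) + θ⌋, ?_, by simp [auxIncr, hn, F]⟩
        rw [sub_nonneg]
        apply Int.floor_le_floor
        simp only [hX]
        rw [aux_sum_succ _ _ _ hn]
        linarith [hx.1 n]
    obtain ⟨z, hz, h⟩ := this
    lift z to ℕ using hz
    exact ⟨z, by simpa using h⟩
  refine ⟨tr.auxIncr (F θ), ⟨?_, ?_⟩, ?_, hnat, hOI ▸ hθ⟩
  · intro n
    obtain ⟨z, hz⟩ := hnat n
    rw [hz]; positivity
  · intro n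
    rw [aux_sum_incr]
    obtain ⟨z, h1, h2⟩ := tr.aux_ceil_le δ x t ht hx hc n
    refine h1.trans ?_
    have : z ≤ ⌊X n + θ⌋ := Int.le_floor.2 (by simp only [hX]; linarith)
    exact Int.cast_le.2 this
  · apply aux_incr_adaptive
    intro m n h
    simp only [F, hX, tr.aux_cum_eq t x hc m n h]

end ScenarioTree

theorem aux_capObj_split {T : ℕ} {Node : Type} [Fintype Node] [DecidableEq Node] {I J : ℕ}
    (tr : ScenarioTree T Node) (a : Node → Fin I → ℝ) (b : Node → Fin J → ℝ)
    (x : Node → Fin I → ℝ) (y : Node → Fin J → ℝ) :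
    capObj tr a b x y = ∑ i, tr.lpObj (fun n => a n i) (fun n => x n i)
      + ∑ n, tr.prob n * ∑ j, b n j * y n j := by
  unfold capObj ScenarioTree.lpObj
  simp_rw [mul_add, Finset.sum_add_distrib, Finset.mul_sum]
  rw [Finset.sum_comm]
  simp_rw [mul_assoc]

theorem aux_capObj_nonneg {T : ℕ} {Node : Type} [Fintype Node] [DecidableEq Node] {I J : ℕ}
    (tr : ScenarioTree T Node) (a : Node → Fin I → ℝ) (b : Node → Fin J → ℝ)
    (ha : ∀ n i, 0 ≤ a n i) (hb : ∀ n j, 0 ≤ b n j)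
    (x : Node → Fin I → ℝ) (y : Node → Fin J → ℝ)
    (hx : ∀ n i, 0 ≤ x n i) (hy : ∀ n j, 0 ≤ y n j) : 0 ≤ capObj tr a b x y :=
  Finset.sum_nonneg fun n _ => mul_nonneg (tr.prob_pos n).le
    (add_nonneg (Finset.sum_nonneg fun i _ => mul_nonneg (ha n i) (hx n i))
      (Finset.sum_nonneg fun j _ => mul_nonneg (hb n j) (hy n j)))

theorem aux_lpObj_nonneg {T : ℕ} {Node : Type} [Fintype Node] [DecidableEq Node]
    (tr : ScenarioTree T Node) (a x : Node → ℝ)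
    (ha : ∀ n, 0 ≤ a n) (hx : ∀ n, 0 ≤ x n) : 0 ≤ tr.lpObj a x :=
  Finset.sum_nonneg fun n _ => mul_nonneg (mul_nonneg (tr.prob_pos n).le (ha n)) (hx n)

/-- **Proposition 9**: if `y^{TLP}` is an optimal capacity allocation of the LP
relaxation of the two-stage capacity expansion problem and `δ_{in} = [A_n y^{TLP}_n]_i`,
then for any revision vector `t*`,
`V^{TS} − V^{ATS}(t*) ≥ ∑_i (v_i^T − v_i^R(t_i*) − max_{n ∈ 𝒯_i(t_i*)}(⌈δ_{in}⌉ − δ_{in}) a_{i1})`. -/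
theorem VTS_sub_VATS_lower_bound
    {T : ℕ} {Node : Type} [Fintype Node] [DecidableEq Node] {I J K : ℕ}
    (tr : ScenarioTree T Node)
    (a : Node → Fin I → ℝ) (b : Node → Fin J → ℝ)
    (A : Node → Matrix (Fin I) (Fin J) ℝ) (B : Node → Matrix (Fin K) (Fin J) ℝ)
    (dem : Node → Fin K → ℝ)
    (ha : ∀ n i, 0 ≤ a n i) (hb : ∀ n j, 0 ≤ b n j)
    (hA : ∀ n i j, 0 ≤ A n i j) (hB : ∀ n k j, 0 ≤ B n k j)
    (hdem : ∀ n k, 0 ≤ dem n k)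
    (xTLP : Node → Fin I → ℝ) (yTLP : Node → Fin J → ℝ)
    (hfeas : capFeas tr A B dem xTLP yTLP)
    (hTSconstr : ∀ i : Fin I, tr.twoStageConstr (fun n => xTLP n i))
    (hopt : capObj tr a b xTLP yTLP =
      sInf {v : ℝ | ∃ x y, capFeas tr A B dem x y ∧
        (∀ i : Fin I, tr.twoStageConstr (fun n => x n i)) ∧ v = capObj tr a b x y})
    (tstar : Fin I → ℕ) (htstar : ∀ i, 1 ≤ tstar i ∧ tstar i ≤ T) :
    ∑ i : Fin I,
      (tr.vT (fun n => a n i) (fun n => (A n).mulVec (yTLP n) i)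
        - tr.vR (fun n => a n i) (fun n => (A n).mulVec (yTLP n) i) (tstar i)
        - tr.condGap (fun n => (A n).mulVec (yTLP n) i) (tstar i) * a tr.root i)
      ≤ VTS tr a b A B dem - VATS tr a b A B dem tstar := by
  have hlp : ∀ i, tr.lpFeas (fun n => (A n).mulVec (yTLP n) i) (fun n => xTLP n i) :=
    fun i => ⟨fun n => hfeas.1 n i, fun n => hfeas.2.2.1 n i⟩
  have hTS : capObj tr a b xTLP yTLP ≤ VTS tr a b A B dem := by
    rw [hopt]
    apply csInf_le_csInf
    · refine ⟨0, ?_⟩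
      rintro _ ⟨x, y, hf, -, rfl⟩
      exact aux_capObj_nonneg tr a b ha hb x y hf.1 hf.2.1
    · refine ⟨_, fun n i => (⌈xTLP n i⌉₊ : ℝ), yTLP, ⟨?_, hfeas.2.1, ?_, hfeas.2.2.2⟩,
        fun n i => ⟨_, rfl⟩, ?_, rfl⟩
      · intro n i; positivity
      · intro n i
        exact (hfeas.2.2.1 n i).trans (Finset.sum_le_sum fun m _ => Nat.le_ceil _)
      · intro i m n h
        have := hTSconstr i m n h
        simp only at this ⊢
        rw [this]
    · rintro _ ⟨x, y, hf, -, hc, rfl⟩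
      exact ⟨x, y, hf, hc, rfl⟩
  have hvT : ∀ i, tr.vT (fun n => a n i) (fun n => (A n).mulVec (yTLP n) i) ≤
      tr.lpObj (fun n => a n i) (fun n => xTLP n i) := by
    intro i
    apply csInf_le
    · refine ⟨0, ?_⟩
      rintro _ ⟨x, ⟨hf, -⟩, rfl⟩
      exact aux_lpObj_nonneg tr _ _ (fun n => ha n i) hf.1
    · exact ⟨_, ⟨hlp i, hTSconstr i⟩, rfl⟩
  set C := ∑ n, tr.prob n * ∑ j, b n j * yTLP n j with hC
  have hATS : VATS tr a b A B dem tstar ≤ ∑ i,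
      (tr.vR (fun n => a n i) (fun n => (A n).mulVec (yTLP n) i) (tstar i)
      + tr.condGap (fun n => (A n).mulVec (yTLP n) i) (tstar i) * a tr.root i) + C := by
    apply le_of_forall_pos_le_add
    intro ε hε
    have hε' : 0 < ε / (I + 1) := by positivity
    have hex : ∀ i, ∃ x' : Node → ℝ, tr.lpFeas (fun n => (A n).mulVec (yTLP n) i) x' ∧
        tr.adaptiveConstr (tstar i) x' ∧ (∀ n, ∃ z : ℕ, x' n = z) ∧
        tr.lpObj (fun n => a n i) x' ≤
          tr.vR (fun n => a n i) (fun n => (A n).mulVec (yTLP n) i) (tstar i)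
      + tr.condGap (fun n => (A n).mulVec (yTLP n) i) (tstar i) * a tr.root i
      + ε / (I + 1) := by
      intro i
      have hne : (tr.lpObj (fun n => a n i) '' {x | tr.lpFeas
          (fun n => (A n).mulVec (yTLP n) i) x ∧ tr.adaptiveConstr (tstar i) x}).Nonempty :=
        ⟨_, _, ⟨hlp i, fun m n h _ => hTSconstr i m n h,
          fun _ _ m n _ _ h => hTSconstr i m n h⟩, rfl⟩
      obtain ⟨_, ⟨x, ⟨hf, hc⟩, rfl⟩, hlt⟩ := exists_lt_of_csInf_lt hne
        (lt_add_of_pos_right _ hε')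
      obtain ⟨x', h1, h2, h3, h4⟩ :=
        tr.aux_round (fun n => a n i) _ x (tstar i) (htstar i).1 hf hc
      refine ⟨x', h1, h2, h3, h4.trans ?_⟩
      unfold ScenarioTree.vR
      linarith
    choose x' h1 h2 h3 h4 using hex
    have hle : VATS tr a b A B dem tstar ≤ capObj tr a b (fun n i => x' i n) yTLP := by
      apply csInf_le
      · refine ⟨0, ?_⟩
        rintro _ ⟨x, y, hf, -, -, rfl⟩
        exact aux_capObj_nonneg tr a b ha hb x y hf.1 hf.2.1
      · exact ⟨_, _, ⟨fun n i => (h1 i).1 n, hfeas.2.1, fun n i => (h1 i).2 n, hfeas.2.2.2⟩,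
          fun n i => h3 i n, h2, rfl⟩
    rw [aux_capObj_split] at hle
    have hsum := Finset.sum_le_sum fun i (_ : i ∈ Finset.univ) => h4 i
    rw [Finset.sum_add_distrib] at hsum
    have hI : ∑ _i : Fin I, ε / ((I:ℝ) + 1) ≤ ε := by
      rw [Finset.sum_const, Finset.card_univ, Fintype.card_fin, nsmul_eq_mul, mul_div_assoc',
        div_le_iff₀ (by positivity)]
      linarith
    linarith
  rw [aux_capObj_split] at hTS
  have hs := Finset.sum_le_sum fun i (_ : i ∈ Finset.univ) => hvT i
  rw [Finset.sum_add_distrib] at hATS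
  rw [Finset.sum_sub_distrib, Finset.sum_sub_distrib]
  linarith

end
end
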